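/- arXiv:1806.02734 — 10 statements merged into one kernel-verified Lean document; each statement's English description precedes it below -/
import Mathlib

section
/- Let G be a finite simple graph with inertia (n⁺, n⁰, n⁻). If G admits an orthogonal representation in dimension d (in particular if d = ξ(G)), then n⁺ ≤ (d − 1)·n⁻ and n⁻ ≤ (d − 1)·n⁺; equivalently, if G has at least one edge, then 1 + max(n⁺/n⁻, n⁻/n⁺) ≤ d. -/
open Matrix Finset

/-- The Hermitian form with diagonalization `B = U * diagonal L * Uᵀ` vanishes on the vectors
`∑ v, a v • e v ⊗ x v` when `x v ⊥ x w` whenever `B v w ≠ 0`. -/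
lemma sum_mul_normSq_sum_eq_zero {V ι κ : Type*} [Fintype V] [Fintype ι] [Fintype κ]
    (U : Matrix V ι ℝ) (L : ι → ℝ) (x : V → κ → ℂ)
    (horth : ∀ v w, ∑ i, U v i * L i * U w i ≠ 0 → star (x v) ⬝ᵥ x w = 0) (a : V → ℂ) :
    ∑ k, ∑ i, L i * Complex.normSq (∑ v, U v i * (a v * x v k)) = 0 := by
  have expand : ∑ k, ∑ i, (L i : ℂ) * (star (∑ v, (U v i : ℂ) * (a v * x v k)) *
      ∑ w, (U w i : ℂ) * (a w * x w k)) =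
      ∑ v, ∑ w, ((∑ i, U v i * L i * U w i : ℝ) : ℂ) * (star (a v) * a w) *
        (star (x v) ⬝ᵥ x w) := by
    calc _ = ∑ k, ∑ i, ∑ v, ∑ w, ((U v i : ℂ) * L i * U w i) * (star (a v) * a w) *
          (star (x v k) * x w k) := by
          refine sum_congr rfl fun k _ => sum_congr rfl fun i _ => ?_
          rw [star_sum, sum_mul_sum, mul_sum]
          refine sum_congr rfl fun v _ => ?_
          rw [mul_sum]
          refine sum_congr rfl fun w _ => ?_
          simp only [star_mul', Complex.star_def, Complex.conj_ofReal]
          ring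
      _ = ∑ k, ∑ v, ∑ w, ∑ i, ((U v i : ℂ) * L i * U w i) * (star (a v) * a w) *
          (star (x v k) * x w k) := by
          refine sum_congr rfl fun k _ => ?_
          rw [sum_comm]
          exact sum_congr rfl fun v _ => sum_comm
      _ = ∑ v, ∑ w, ∑ k, ∑ i, ((U v i : ℂ) * L i * U w i) * (star (a v) * a w) *
          (star (x v k) * x w k) := by
          rw [sum_comm]
          exact sum_congr rfl fun v _ => sum_comm
      _ = _ := by
          refine sum_congr rfl fun v _ => sum_congr rfl fun w _ => ?_
          simp only [dotProduct, Complex.ofReal_sum, Complex.ofReal_mul, mul_sum, sum_mul,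
            Pi.star_apply]
  have vanish : ∑ v, ∑ w, ((∑ i, U v i * L i * U w i : ℝ) : ℂ) * (star (a v) * a w) *
      (star (x v) ⬝ᵥ x w) = 0 := by
    refine sum_eq_zero fun v _ => sum_eq_zero fun w _ => ?_
    by_cases h : ∑ i, U v i * L i * U w i = 0
    · simp [h]
    · simp [horth v w h]
  rw [vanish] at expand
  apply Complex.ofReal_injective
  push_cast
  simpa only [Complex.normSq_eq_conj_mul_self, Complex.star_def] using expand

/-- If the real symmetric matrix `U * diagonal L * Uᵀ` is such that `x v ⊥ x w` in `ℂ^κ` for each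
of its non-zero entries `(v, w)`, then its order is at most `|κ|` times its number of negative
eigenvalues plus its nullity. -/
lemma card_le_card_neg_mul_add_card_zero {V ι κ : Type*} [Fintype V] [DecidableEq V] [Fintype ι]
    [Fintype κ] (U : Matrix V ι ℝ) (hU : U * Uᵀ = 1) (L : ι → ℝ) (x : V → κ → ℂ)
    (hx : ∀ v, x v ≠ 0)
    (horth : ∀ v w, ∑ i, U v i * L i * U w i ≠ 0 → star (x v) ⬝ᵥ x w = 0) :
    Fintype.card V ≤
      (univ.filter fun i => L i < 0).card * Fintype.card κ +
        (univ.filter fun i => L i = 0).card := by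
  classical
  obtain ⟨f, hf⟩ := Module.exists_dual_forall_apply_ne_zero (K := ℂ) x hx
  let z (i : ι) : (V → ℂ) →ₗ[ℂ] ℂ := ∑ v, (U v i : ℂ) • LinearMap.proj v
  have z_apply (i : ι) (y : V → ℂ) : z i y = ∑ v, (U v i : ℂ) * y v := by simp [z]
  have eq_zero_of_z (y : V → ℂ) (hy : ∀ i, z i y = 0) : y = 0 := by
    have hU' : (U.map Complex.ofRealHom) * (U.map Complex.ofRealHom)ᵀ = 1 := by
      rw [← transpose_map, ← Matrix.map_mul, hU, Matrix.map_one] <;> simp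
    have : (U.map Complex.ofRealHom)ᵀ *ᵥ y = 0 := by
      ext i
      simpa [z_apply, mulVec, dotProduct] using hy i
    rw [← one_mulVec y, ← hU', ← mulVec_mulVec, this, mulVec_zero]
  let y (k : κ) : (V → ℂ) →ₗ[ℂ] (V → ℂ) :=
    LinearMap.pi fun v => x v k • LinearMap.proj v
  let g : (V → ℂ) →ₗ[ℂ] (V → ℂ) := LinearMap.pi fun v => f (x v) • LinearMap.proj v
  have g_eq (a : V → ℂ) : g a = ∑ k, f (Pi.single k 1) • y k a := by
    ext v
    have : x v = ∑ k, x v k • (Pi.single k 1 : κ → ℂ) := by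
      ext j; simp [Pi.single_apply]
    simp only [g, y, LinearMap.pi_apply, LinearMap.smul_apply, LinearMap.proj_apply, smul_eq_mul,
      Finset.sum_apply, Pi.smul_apply]
    conv_lhs => rw [this]
    simp only [map_sum, map_smul, smul_eq_mul, sum_mul]
    exact sum_congr rfl fun k _ => by ring
  let T : (V → ℂ) →ₗ[ℂ] (({i // L i < 0} × κ ⊕ {i // L i = 0}) → ℂ) :=
    LinearMap.pi (Sum.elim (fun p => z p.1 ∘ₗ y p.2) (fun i => z i ∘ₗ g))
  have hT : Function.Injective T := by
    rw [injective_iff_map_eq_zero]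
    intro a ha
    have hneg (i) (hi : L i < 0) (k) : z i (y k a) = 0 := congrFun ha (Sum.inl (⟨i, hi⟩, k))
    have hzero (i) (hi : L i = 0) : z i (g a) = 0 := congrFun ha (Sum.inr ⟨i, hi⟩)
    have form : ∑ k, ∑ i, L i * Complex.normSq (z i (y k a)) = 0 := by
      rw [← sum_mul_normSq_sum_eq_zero U L x horth a]
      simp [z_apply, y, mul_comm]
    have nonneg (k i) : 0 ≤ L i * Complex.normSq (z i (y k a)) := by
      rcases lt_or_ge (L i) 0 with hi | hi
      · simp [hneg i hi k]
      · exact mul_nonneg hi (Complex.normSq_nonneg _)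
    have hne (i) (hi : L i ≠ 0) (k) : z i (y k a) = 0 := by
      have h := (sum_eq_zero_iff_of_nonneg fun k _ => sum_nonneg fun i _ => nonneg k i).1 form k
        (mem_univ k)
      have h' := (sum_eq_zero_iff_of_nonneg fun i _ => nonneg k i).1 h i (mem_univ i)
      exact Complex.normSq_eq_zero.1 ((mul_eq_zero.1 h').resolve_left hi)
    have hg : g a = 0 := eq_zero_of_z _ fun i => by
      by_cases hi : L i = 0
      · exact hzero i hi
      · rw [g_eq]
        simp [hne i hi]
    ext v
    have : f (x v) * a v = 0 := congrFun hg v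
    exact (mul_eq_zero.1 this).resolve_left (hf v)
  simpa [Fintype.card_subtype] using LinearMap.finrank_le_finrank_of_injective hT

/-- Inertial lower bound for the orthogonal rank: if `G` admits an orthogonal
representation in dimension `d`, then `n⁺ ≤ (d-1)·n⁻` and `n⁻ ≤ (d-1)·n⁺`;
equivalently, if `G` has an edge, `1 + max(n⁺/n⁻, n⁻/n⁺) ≤ d`. -/
theorem inertial_lower_bound_orthogonal_rank
    {V : Type*} [Fintype V] [DecidableEq V] (G : SimpleGraph V) [DecidableRel G.Adj]
    (hA : (SimpleGraph.adjMatrix ℝ G).IsHermitian)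
    (nplus nzero nminus : ℕ)
    (hplus : nplus = (univ.filter fun i => 0 < hA.eigenvalues i).card)
    (hzero : nzero = (univ.filter fun i => hA.eigenvalues i = 0).card)
    (hminus : nminus = (univ.filter fun i => hA.eigenvalues i < 0).card)
    (d : ℕ) (x : V → Fin d → ℂ)
    (hx : ∀ v, x v ≠ 0)
    (horth : ∀ v w, G.Adj v w → star (x v) ⬝ᵥ x w = 0) :
    (nplus ≤ (d - 1) * nminus ∧ nminus ≤ (d - 1) * nplus) ∧
      ((∃ v w, G.Adj v w) →
        1 + max ((nplus : ℝ) / (nminus : ℝ)) ((nminus : ℝ) / (nplus : ℝ)) ≤ (d : ℝ)) := by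
  let U : Matrix V V ℝ := hA.eigenvectorUnitary
  have hU : U * Uᵀ = 1 := Unitary.mul_star_self_of_mem hA.eigenvectorUnitary.2
  have spectral (v w) : G.adjMatrix ℝ v w = ∑ i, U v i * hA.eigenvalues i * U w i := by
    have h := congrFun (congrFun hA.spectral_theorem v) w
    rw [Unitary.conjStarAlgAut_apply, Matrix.mul_apply] at h
    simpa [U, mul_diagonal, star_apply] using h
  have card_eq : Fintype.card V = nplus + nzero + nminus := by
    rw [hplus, hzero, hminus, ← card_univ, ← card_union_of_disjoint, ← card_union_of_disjoint]
    · congr 1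
      ext i
      simpa [or_assoc] using (lt_trichotomy 0 (hA.eigenvalues i)).imp_right (.imp_left Eq.symm)
    · exact disjoint_left.2 fun i hi hi' => by simp at hi hi'; grind
    · exact disjoint_left.2 fun i hi hi' => by simp at hi hi'; linarith
  have orth (v w) (h : ∑ i, U v i * hA.eigenvalues i * U w i ≠ 0) : star (x v) ⬝ᵥ x w = 0 := by
    rw [← spectral] at h
    exact horth v w (by simpa using h)
  have hle := card_le_card_neg_mul_add_card_zero U hU hA.eigenvalues x hx orth
  have hge := card_le_card_neg_mul_add_card_zero U hU (-hA.eigenvalues) x hx fun v w h =>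
    orth v w (by simpa using h)
  simp only [Pi.neg_apply, neg_lt_zero, neg_eq_zero, Fintype.card_fin, ← hplus, ← hzero,
    ← hminus, card_eq] at hle hge
  have key : nplus + nminus ≤ d * nminus ∧ nplus + nminus ≤ d * nplus :=
    ⟨by linarith, by linarith⟩
  refine ⟨⟨by rw [Nat.sub_one_mul]; omega, by rw [Nat.sub_one_mul]; omega⟩, ?_⟩
  rintro ⟨v, w, hvw⟩
  have hpos : 0 < nplus + nminus := by
    by_contra! h0
    have h1 : G.adjMatrix ℝ = 0 := hA.eigenvalues_eq_zero_iff.1 <| funext fun i => by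
      have hp : nplus = 0 := by omega
      have hm : nminus = 0 := by omega
      rw [hplus, card_eq_zero, filter_eq_empty_iff] at hp
      rw [hminus, card_eq_zero, filter_eq_empty_iff] at hm
      exact le_antisymm (not_lt.1 (hp (mem_univ i))) (not_lt.1 (hm (mem_univ i)))
    simpa [hvw] using congrFun (congrFun h1 v) w
  have hm : 0 < nminus := Nat.pos_of_ne_zero fun h => by simp [h] at key; omega
  have hp : 0 < nplus := Nat.pos_of_ne_zero fun h => by simp [h] at key; omega
  rw [← le_sub_iff_add_le', max_le_iff, div_le_iff₀ (by positivity), div_le_iff₀ (by positivity)]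
  have key' : (nplus + nminus : ℝ) ≤ d * nminus ∧ (nplus + nminus : ℝ) ≤ d * nplus := by
    exact_mod_cast key
  constructor <;> linarith
end

section
/- Weighted version of the inertial bound for the orthogonal rank: let G be a finite simple graph on vertex set V and let M be a Hermitian V × V complex matrix such that M_{vw} = 0 whenever v and w are not adjacent in G (in particular all diagonal entries of M are zero). Let p, z, q be the numbers of positive, zero and negative eigenvalues of M, counted with multiplicity. If G admits an orthogonal representation in dimension d, then p ≤ (d − 1)·q and q ≤ (d − 1)·p. -/
open Matrix Finset

/-- A finite family of nonzero vectors can be moved by a unitary so that all first coordinates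
become nonzero. -/
lemma exists_first_coord_ne_zero_of_forall_ne_zero {V : Type*} [Finite V] {n : ℕ}
    (x : V → Fin (n + 1) → ℂ) (hx : ∀ v, x v ≠ 0) :
    ∃ x' : V → Fin (n + 1) → ℂ, (∀ v, x' v 0 ≠ 0) ∧
      ∀ v w, star (x' v) ⬝ᵥ x' w = star (x v) ⬝ᵥ x w := by
  cases isEmpty_or_nonempty V with
  | inl h => exact ⟨x, fun v => h.elim v, fun _ _ => rfl⟩
  | inr h =>
    let X (v : V) : EuclideanSpace ℂ (Fin (n + 1)) := WithLp.toLp 2 (x v)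
    have hX (v : V) : X v ≠ 0 := by simpa [X] using hx v
    obtain ⟨u, hu⟩ := Module.Dual.exists_forall_ne_zero_of_forall_exists
      (fun v => (innerSL ℂ (X v)).toLinearMap) (fun v => ⟨X v, by simpa using hX v⟩)
    have hu0 : u ≠ 0 := by
      rintro rfl
      exact hu h.some (map_zero _)
    have hnorm : ‖((‖u‖ : ℂ)⁻¹ • u)‖ = 1 := norm_smul_inv_norm hu0
    obtain ⟨b, hb⟩ := Orthonormal.exists_orthonormalBasis_extension_of_card_eq
      (𝕜 := ℂ) (E := EuclideanSpace ℂ (Fin (n + 1))) (ι := Fin (n + 1)) (by simp)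
      (v := fun _ => (‖u‖ : ℂ)⁻¹ • u) (s := {0})
      ⟨fun _ => hnorm, fun i j hij => (hij (Subsingleton.elim i j)).elim⟩
    refine ⟨fun v => b.repr (X v), fun v => ?_, fun v w => ?_⟩
    · beta_reduce
      rw [b.repr_apply_apply, hb 0 rfl, inner_smul_left]
      refine mul_ne_zero (by simpa using hu0) ?_
      exact mt inner_eq_zero_symm.1 (hu v)
    · rw [dotProduct_comm, ← EuclideanSpace.inner_eq_star_dotProduct,
        b.repr.inner_map_map, EuclideanSpace.inner_eq_star_dotProduct, dotProduct_comm]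

/-- If the quadratic form of `M` is diagonalised by `c` with coefficients `μ`, and the entries of
`M` vanish wherever the vectors `x v`, `x w` are not orthogonal, then the positive coefficients
number at most `n` times the negative ones. -/
lemma card_pos_le_mul_card_neg {V : Type*} [Fintype V] (M : Matrix V V ℂ) (μ : V → ℝ)
    (c : (V → ℂ) ≃ₗ[ℂ] (V → ℂ))
    (hc : ∀ y, star y ⬝ᵥ M *ᵥ y = ((∑ i, μ i * Complex.normSq (c y i) : ℝ) : ℂ))
    {n : ℕ} (x : V → Fin (n + 1) → ℂ) (hx : ∀ v, x v 0 ≠ 0)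
    (hM : ∀ v w, M v w * (star (x v) ⬝ᵥ x w) = 0) :
    #{i | 0 < μ i} ≤ n * #{i | μ i < 0} := by
  classical
  by_contra! hlt
  let S : ({i // 0 < μ i} → ℂ) →ₗ[ℂ] (V → ℂ) :=
    LinearMap.mulLeft ℂ (fun v => (x v 0)⁻¹) ∘ₗ c.symm.toLinearMap ∘ₗ
      Function.ExtendByZero.linearMap ℂ Subtype.val
  let F : ({i // 0 < μ i} → ℂ) →ₗ[ℂ] (Fin n × {i // μ i < 0} → ℂ) :=
    LinearMap.pi fun kj => LinearMap.proj kj.2.1 ∘ₗ c.toLinearMap ∘ₗ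
      LinearMap.mulLeft ℂ (fun v => x v kj.1.succ) ∘ₗ S
  have hF : LinearMap.ker F ≠ ⊥ := by
    apply LinearMap.ker_ne_bot_of_finrank_lt
    simpa [Fintype.card_subtype] using hlt
  obtain ⟨a, ha, ha0⟩ := (Submodule.ne_bot_iff _).1 hF
  set y : V → ℂ := S a with hy
  let D (k : Fin (n + 1)) : V → ℂ := fun v => x v k * y v
  have hsum : ∑ k, star (D k) ⬝ᵥ M *ᵥ D k = 0 := by
    have key (v w : V) : ∑ k, star (D k v) * (M v w * D k w) = 0 := by
      have : ∑ k, star (D k v) * (M v w * D k w)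
          = star (y v) * y w * (M v w * (star (x v) ⬝ᵥ x w)) := by
        simp only [dotProduct, Finset.mul_sum, D, star_mul', Pi.star_apply]
        exact Finset.sum_congr rfl fun k _ => by ring
      rw [this, hM, mul_zero]
    simp only [dotProduct, mulVec, Finset.mul_sum, Pi.star_apply]
    rw [Finset.sum_comm]
    refine Finset.sum_eq_zero fun v _ => ?_
    rw [Finset.sum_comm]
    exact Finset.sum_eq_zero fun w _ => key v w
  simp only [hc] at hsum
  rw [← Complex.ofReal_sum, Complex.ofReal_eq_zero, Fin.sum_univ_succ] at hsum
  have hD0 : c (D 0) = Function.extend Subtype.val a 0 := by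
    have : D 0 = c.symm (Function.extend Subtype.val a 0) := by
      funext v
      simp [D, hy, S, hx v]
      rfl
    rw [this, c.apply_symm_apply]
  have hval (i : {i // 0 < μ i}) : c (D 0) i = a i := by
    rw [hD0, Subtype.val_injective.extend_apply]
  have hnonpos (i : V) (hi : ¬ 0 < μ i) : c (D 0) i = 0 := by
    rw [hD0, Function.extend_apply' _ _ _ (by rintro ⟨j, rfl⟩; exact hi j.2)]
    rfl
  have hpos : 0 < ∑ i, μ i * Complex.normSq (c (D 0) i) := by
    obtain ⟨i, hi⟩ := Function.ne_iff.1 ha0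
    refine Finset.sum_pos' (fun j _ => ?_) ⟨i, mem_univ _, ?_⟩
    · by_cases hj : 0 < μ j
      · exact mul_nonneg hj.le (Complex.normSq_nonneg _)
      · simp [hnonpos j hj]
    · rw [hval]
      exact mul_pos i.2 (Complex.normSq_pos.2 hi)
  have hnonneg : 0 ≤ ∑ k : Fin n, ∑ i, μ i * Complex.normSq (c (D k.succ) i) := by
    refine Finset.sum_nonneg fun k _ => Finset.sum_nonneg fun j _ => ?_
    by_cases hj : μ j < 0
    · have : c (D k.succ) j = 0 := congrFun (LinearMap.mem_ker.1 ha) (k, ⟨j, hj⟩)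
      simp [this]
    · exact mul_nonneg (not_lt.1 hj) (Complex.normSq_nonneg _)
  linarith

/-- The quadratic form of a Hermitian matrix is diagonal in its eigenvector coordinates. -/
lemma Matrix.IsHermitian.exists_linearEquiv_star_dotProduct_mulVec {V : Type*} [Fintype V]
    [DecidableEq V] {M : Matrix V V ℂ} (hM : M.IsHermitian) :
    ∃ c : (V → ℂ) ≃ₗ[ℂ] (V → ℂ), ∀ y, star y ⬝ᵥ M *ᵥ y =
      ((∑ i, hM.eigenvalues i * Complex.normSq (c y i) : ℝ) : ℂ) := by
  let U : Matrix V V ℂ := hM.eigenvectorUnitary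
  have hU : U * star U = 1 := Unitary.coe_mul_star_self _
  have hU' : star U * U = 1 := Unitary.coe_star_mul_self _
  refine ⟨Matrix.toLin'OfInv hU hU', fun y => ?_⟩
  have hspec : M = U * diagonal (RCLike.ofReal ∘ hM.eigenvalues) * star U := by
    conv_lhs => rw [hM.spectral_theorem, Unitary.conjStarAlgAut_apply]
  have hstar : star y ᵥ* U = star (star U *ᵥ y) := by
    rw [star_mulVec, star_eq_conjTranspose, conjTranspose_conjTranspose]
  conv_lhs => rw [hspec, ← mulVec_mulVec, ← mulVec_mulVec, dotProduct_mulVec, hstar]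
  rw [Complex.ofReal_sum]
  refine Finset.sum_congr rfl fun i _ => ?_
  rw [mulVec_diagonal]
  simp [Complex.normSq_eq_conj_mul_self, Matrix.toLin'OfInv]
  ring



/-- Weighted version of the inertial bound for the orthogonal rank: for a Hermitian
matrix `M` supported on the edges of `G`, with `p`, `z`, `q` positive/zero/negative
eigenvalue counts, an orthogonal representation of `G` in dimension `d` forces
`p ≤ (d-1)·q` and `q ≤ (d-1)·p`. -/
theorem weighted_inertial_lower_bound_orthogonal_rank
    {V : Type*} [Fintype V] [DecidableEq V] (G : SimpleGraph V) [DecidableRel G.Adj]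
    (M : Matrix V V ℂ) (hM : M.IsHermitian)
    (hsupp : ∀ v w, ¬ G.Adj v w → M v w = 0)
    (p z q : ℕ)
    (hp : p = (univ.filter fun i => 0 < hM.eigenvalues i).card)
    (hz : z = (univ.filter fun i => hM.eigenvalues i = 0).card)
    (hq : q = (univ.filter fun i => hM.eigenvalues i < 0).card)
    (d : ℕ) (x : V → Fin d → ℂ)
    (hx : ∀ v, x v ≠ 0)
    (horth : ∀ v w, G.Adj v w → star (x v) ⬝ᵥ x w = 0) :
    p ≤ (d - 1) * q ∧ q ≤ (d - 1) * p := by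
  subst hp hq
  cases isEmpty_or_nonempty V with
  | inl h => simp
  | inr h =>
    obtain _ | n := d
    · exact (hx h.some (Subsingleton.elim _ _)).elim
    obtain ⟨x', hx', hxx'⟩ := exists_first_coord_ne_zero_of_forall_ne_zero x hx
    have hzero (v w : V) : M v w * (star (x' v) ⬝ᵥ x' w) = 0 := by
      rw [hxx']
      by_cases hvw : G.Adj v w
      · rw [horth v w hvw, mul_zero]
      · rw [hsupp v w hvw, zero_mul]
    obtain ⟨c, hc⟩ := hM.exists_linearEquiv_star_dotProduct_mulVec
    refine ⟨card_pos_le_mul_card_neg M hM.eigenvalues c hc x' hx' hzero, ?_⟩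
    have := card_pos_le_mul_card_neg (-M) (-hM.eigenvalues) c
      (fun y => by simp [neg_mulVec, hc]) x' hx' (fun v w => by simp [hzero])
    simpa using this
end

section
/- Hoffman-type bound for the vectorial chromatic number: let G be a finite simple graph with at least one edge and adjacency eigenvalues μ₁ ≥ … ≥ μₙ. If G admits a vectorial c-coloring, then μ₁ ≤ (c − 1)·|μₙ|; equivalently, 1 + μ₁/|μₙ| ≤ c, so 1 + μ₁/|μₙ| ≤ χ_vect(G). -/
open Matrix Finset
open scoped ComplexOrder

/-- The smallest eigenvalue bounds the quadratic form of a real symmetric matrix from below. -/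
theorem Matrix.IsHermitian.iInf_eigenvalues_mul_dotProduct_le
    {V : Type*} [Fintype V] [DecidableEq V] {A : Matrix V V ℝ} (hA : A.IsHermitian) (g : V → ℝ) :
    (⨅ i, hA.eigenvalues i) * (g ⬝ᵥ g) ≤ g ⬝ᵥ (A *ᵥ g) := by
  set b := hA.eigenvectorBasis
  have hself : g ⬝ᵥ g = ∑ i, (g ⬝ᵥ ⇑(b i)) ^ 2 := by
    have := b.sum_inner_mul_inner (WithLp.toLp 2 g) (WithLp.toLp 2 g)
    simp only [EuclideanSpace.inner_eq_star_dotProduct, star_trivial] at this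
    rw [← this]
    exact Finset.sum_congr rfl fun i _ => by rw [dotProduct_comm g, sq]
  have hmul : g ⬝ᵥ (A *ᵥ g) = ∑ i, hA.eigenvalues i * (g ⬝ᵥ ⇑(b i)) ^ 2 := by
    have := b.sum_inner_mul_inner (WithLp.toLp 2 g) (WithLp.toLp 2 (A *ᵥ g))
    simp only [EuclideanSpace.inner_eq_star_dotProduct, star_trivial] at this
    rw [dotProduct_comm, ← this]
    refine Finset.sum_congr rfl fun i _ => ?_
    have hswap : (A *ᵥ g) ⬝ᵥ ⇑(b i) = g ⬝ᵥ (A *ᵥ ⇑(b i)) := by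
      rw [dotProduct_mulVec, ← mulVec_transpose, ← conjTranspose_eq_transpose_of_trivial, hA.eq]
    rw [hswap, hA.mulVec_eigenvectorBasis, dotProduct_smul, dotProduct_comm _ g, smul_eq_mul]
    ring
  rw [hself, hmul, Finset.mul_sum]
  exact Finset.sum_le_sum fun i _ =>
    mul_le_mul_of_nonneg_right (ciInf_le (Set.finite_range _).bddBelow i) (sq_nonneg _)

/-- The smallest eigenvalue bounds the weighted trace pairing of a real symmetric matrix with a
Gram matrix of complex vectors from below. -/
theorem Matrix.IsHermitian.iInf_eigenvalues_mul_sum_gram_le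
    {V ι : Type*} [Fintype V] [DecidableEq V] [Fintype ι]
    {A : Matrix V V ℝ} (hA : A.IsHermitian) (f : V → ℝ) (z : V → ι → ℂ) :
    (⨅ i, hA.eigenvalues i) * ∑ v, f v ^ 2 * (star (z v) ⬝ᵥ z v).re ≤
      ∑ v, ∑ w, A v w * (f v * f w * (star (z v) ⬝ᵥ z w).re) := by
  have key := Finset.sum_le_sum fun k (_ : k ∈ (Finset.univ : Finset ι)) => add_le_add
    (hA.iInf_eigenvalues_mul_dotProduct_le fun v => f v * (z v k).re)
    (hA.iInf_eigenvalues_mul_dotProduct_le fun v => f v * (z v k).im)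
  refine le_of_eq_of_le ?_ (key.trans_eq ?_)
  · simp only [dotProduct, ← Finset.sum_add_distrib, Complex.re_sum, Finset.mul_sum]
    rw [Finset.sum_comm]
    refine Finset.sum_congr rfl fun k _ => Finset.sum_congr rfl fun v _ => ?_
    simp
    ring
  · symm
    simp only [dotProduct, mulVec, ← Finset.sum_add_distrib, Complex.re_sum, Finset.mul_sum]
    rw [Finset.sum_comm (s := (Finset.univ : Finset ι))]
    refine Finset.sum_congr rfl fun v _ => ?_
    rw [Finset.sum_comm]
    refine Finset.sum_congr rfl fun k _ => Finset.sum_congr rfl fun w _ => ?_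
    simp
    ring

/-- Centring the vectors of two decompositions of a unit vector `y` into `c` parts lowers the sum
of their inner products by `1 / c`. -/
theorem sum_star_sub_smul_dotProduct_sub_smul {c : ℕ} {ι : Type*} [Fintype ι] (hc : c ≠ 0)
    {p q : Fin c → ι → ℂ} {y : ι → ℂ} (hp : ∑ i, p i = y) (hq : ∑ i, q i = y)
    (hy : star y ⬝ᵥ y = 1) :
    ∑ i, star (p i - (c : ℂ)⁻¹ • y) ⬝ᵥ (q i - (c : ℂ)⁻¹ • y) =
      ∑ i, star (p i) ⬝ᵥ q i - (c : ℂ)⁻¹ := by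
  have hpy : ∑ i, star (p i) ⬝ᵥ y = 1 := by rw [← sum_dotProduct, ← star_sum, hp, hy]
  have hyq : ∑ i, star y ⬝ᵥ q i = 1 := by rw [← dotProduct_sum, hq, hy]
  have hc' : (c : ℂ) ≠ 0 := Nat.cast_ne_zero.mpr hc
  simp only [star_sub, star_smul, sub_dotProduct, dotProduct_sub, dotProduct_smul, smul_dotProduct,
    Finset.sum_sub_distrib, ← Finset.smul_sum, hpy, hyq, hy]
  simp [hc]



/-- Hoffman-type bound for the vectorial chromatic number: if `G` has an edge and
admits a vectorial `c`-coloring, then `μ₁ ≤ (c-1)·|μₙ|`, equivalently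
`1 + μ₁/|μₙ| ≤ c`. -/
theorem hoffman_bound_vectorial_chromatic_number
    {V : Type*} [Fintype V] [DecidableEq V] (G : SimpleGraph V) [DecidableRel G.Adj]
    (hedge : ∃ v w, G.Adj v w)
    (hA : (SimpleGraph.adjMatrix ℝ G).IsHermitian)
    (c d : ℕ) (x : V → Fin c → Fin d → ℂ) (y : Fin d → ℂ)
    (h1 : ∀ v w : V, ∀ i j : Fin c, 0 ≤ star (x v i) ⬝ᵥ x w j)
    (h2 : ∀ v : V, ∑ i, x v i = y)
    (hy : star y ⬝ᵥ y = 1)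
    (h3 : ∀ v : V, ∀ i j : Fin c, i ≠ j → star (x v i) ⬝ᵥ x v j = 0)
    (h4 : ∀ v w : V, G.Adj v w → ∀ i : Fin c, star (x v i) ⬝ᵥ x w i = 0) :
    (⨆ i, hA.eigenvalues i) ≤ ((c : ℝ) - 1) * |⨅ i, hA.eigenvalues i| ∧
      1 + (⨆ i, hA.eigenvalues i) / |⨅ i, hA.eigenvalues i| ≤ (c : ℝ) := by
  obtain ⟨v₀, -, -⟩ := hedge
  have : Nonempty V := ⟨v₀⟩
  have hc : c ≠ 0 := by
    rintro rfl
    have h := h2 v₀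
    simp only [Finset.univ_eq_empty, Finset.sum_empty] at h
    simp [← h] at hy
  have hcpos : (0 : ℝ) < c := by positivity
  have hc1 : (1 : ℝ) ≤ c := by exact_mod_cast Nat.one_le_iff_ne_zero.mpr hc
  set z : Fin c → V → Fin d → ℂ := fun i v => x v i - (c : ℂ)⁻¹ • y
  have hgram (v w : V) : ∑ i, (star (z i v) ⬝ᵥ z i w).re =
      (∑ i, star (x v i) ⬝ᵥ x w i).re - (c : ℝ)⁻¹ := by
    rw [← Complex.re_sum, sum_star_sub_smul_dotProduct_sub_smul hc (h2 v) (h2 w) hy, Complex.sub_re,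
      ← Complex.ofReal_natCast, ← Complex.ofReal_inv, Complex.ofReal_re]
  have hdiag (v : V) : ∑ i, (star (z i v) ⬝ᵥ z i v).re = 1 - (c : ℝ)⁻¹ := by
    have hsum : ∑ i, star (x v i) ⬝ᵥ x v i = 1 := by
      rw [← hy]
      conv_rhs => rw [← h2 v, star_sum, sum_dotProduct]
      refine Finset.sum_congr rfl fun i _ => ?_
      rw [dotProduct_sum, Finset.sum_eq_single i (fun j _ hj => h3 v i j hj.symm) (by simp)]
    rw [hgram, hsum, Complex.one_re]
  have hadj (v w : V) (h : G.Adj v w) : ∑ i, (star (z i v) ⬝ᵥ z i w).re = -(c : ℝ)⁻¹ := by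
    rw [hgram, Finset.sum_eq_zero fun i _ => h4 v w h i]
    simp
  obtain ⟨k, hk⟩ := exists_eq_ciSup_of_finite (f := hA.eigenvalues)
  set f : V → ℝ := ⇑(hA.eigenvectorBasis k)
  have hf : ∑ v, f v ^ 2 = 1 := by
    rw [← EuclideanSpace.real_norm_sq_eq, hA.eigenvectorBasis.orthonormal.1 k, one_pow]
  have hmul : ∑ v, ∑ w, G.adjMatrix ℝ v w * (f v * f w) = ⨆ i, hA.eigenvalues i := by
    have h : f ⬝ᵥ (G.adjMatrix ℝ *ᵥ f) = hA.eigenvalues k * ∑ v, f v ^ 2 := by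
      rw [hA.mulVec_eigenvectorBasis k, dotProduct_smul, smul_eq_mul]
      simp [dotProduct, sq, f]
    rw [← hk, ← mul_one (hA.eigenvalues k), ← hf, ← h]
    simp only [dotProduct, mulVec, Finset.mul_sum]
    exact Finset.sum_congr rfl fun v _ => Finset.sum_congr rfl fun w _ => by ring
  have hsum := Finset.sum_le_sum fun i (_ : i ∈ (Finset.univ : Finset (Fin c))) =>
    hA.iInf_eigenvalues_mul_sum_gram_le f (z i)
  have hleft : ∑ i, (⨅ i, hA.eigenvalues i) * ∑ v, f v ^ 2 * (star (z i v) ⬝ᵥ z i v).re =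
      (⨅ i, hA.eigenvalues i) * (1 - (c : ℝ)⁻¹) := by
    rw [← Finset.mul_sum, Finset.sum_comm]
    simp only [← Finset.mul_sum, hdiag]
    rw [← Finset.sum_mul, hf, one_mul]
  have hright : ∑ i, ∑ v, ∑ w, G.adjMatrix ℝ v w * (f v * f w * (star (z i v) ⬝ᵥ z i w).re) =
      (⨆ i, hA.eigenvalues i) * -(c : ℝ)⁻¹ := by
    rw [← hmul, Finset.sum_comm, Finset.sum_mul]
    refine Finset.sum_congr rfl fun v _ => ?_
    rw [Finset.sum_comm, Finset.sum_mul]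
    refine Finset.sum_congr rfl fun w _ => ?_
    rw [← Finset.mul_sum, ← Finset.mul_sum]
    by_cases h : G.Adj v w
    · rw [hadj v w h, ← mul_assoc]
    · simp [h]
  rw [hleft, hright] at hsum
  have hbound : (⨆ i, hA.eigenvalues i) ≤ ((c : ℝ) - 1) * |⨅ i, hA.eigenvalues i| := by
    have h := mul_le_mul_of_nonneg_left hsum hcpos.le
    have e1 : (c : ℝ) * ((⨅ i, hA.eigenvalues i) * (1 - (c : ℝ)⁻¹)) =
        (c - 1) * ⨅ i, hA.eigenvalues i := by field_simp
    have e2 : (c : ℝ) * ((⨆ i, hA.eigenvalues i) * -(c : ℝ)⁻¹) = -⨆ i, hA.eigenvalues i := by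
      field_simp
    rw [e1, e2] at h
    have h' := mul_le_mul_of_nonneg_left (neg_abs_le (⨅ i, hA.eigenvalues i)) (sub_nonneg.mpr hc1)
    linarith
  refine ⟨hbound, ?_⟩
  have := div_le_of_le_mul₀ (abs_nonneg _) (sub_nonneg.mpr hc1) hbound
  linarith
end

section
/- Lima-type bound for the vectorial chromatic number: let G be a finite simple graph with n vertices and m ≥ 1 edges, and let δₙ be the least eigenvalue of the signless Laplacian Q = D + A. If G admits a vectorial c-coloring, then 2m ≤ (c − 1)·(2m − n·δₙ); equivalently, 1 + 2m/(2m − n·δₙ) ≤ c, so 1 + 2m/(2m − n·δₙ) ≤ χ_vect(G). -/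
open Matrix Finset
open scoped ComplexOrder

namespace Matrix

/-- Subtracting the least eigenvalue from a real symmetric matrix makes it positive semidefinite. -/
lemma IsHermitian.posSemidef_sub_iInf_eigenvalues {V : Type*} [Fintype V] [DecidableEq V]
    {Q : Matrix V V ℝ} (hQ : Q.IsHermitian) :
    (Q - algebraMap ℝ (Matrix V V ℝ) (⨅ i, hQ.eigenvalues i)).PosSemidef := by
  rw [Matrix.posSemidef_iff_isHermitian_and_spectrum_nonneg]
  refine ⟨hQ.sub ?_, ?_⟩
  · rw [Matrix.algebraMap_eq_diagonal]
    exact Matrix.isHermitian_diagonal _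
  · rw [← spectrum.sub_singleton_eq, hQ.spectrum_real_eq_range_eigenvalues]
    rintro _ ⟨_, ⟨i, rfl⟩, _, rfl, rfl⟩
    exact sub_nonneg.2 (ciInf_le (Set.finite_range hQ.eigenvalues).bddBelow i)

/-- The entrywise product of a real positive semidefinite matrix with the real part of a complex
Gram matrix has nonnegative sum. -/
lemma PosSemidef.sum_mul_re_dotProduct_nonneg {V ι : Type*} [Fintype V] [Fintype ι]
    {P : Matrix V V ℝ} (hP : P.PosSemidef) (z : V → ι → ℂ) :
    0 ≤ ∑ v, ∑ w, P v w * (star (z v) ⬝ᵥ z w).re := by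
  have hq (a : V → ℝ) : 0 ≤ ∑ v, ∑ w, P v w * (a v * a w) := by
    have h := hP.dotProduct_mulVec_nonneg a
    simp only [dotProduct, mulVec, Pi.star_apply, star_trivial, Finset.mul_sum] at h
    exact h.trans_eq (sum_congr rfl fun v _ => sum_congr rfl fun w _ => by ring)
  have h : ∑ v, ∑ w, P v w * (star (z v) ⬝ᵥ z w).re =
      ∑ k, (∑ v, ∑ w, P v w * ((z v k).re * (z w k).re) +
        ∑ v, ∑ w, P v w * ((z v k).im * (z w k).im)) := by
    simp only [← sum_add_distrib, ← mul_add, dotProduct, Complex.re_sum, mul_sum]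
    rw [sum_comm (s := (univ : Finset ι))]
    refine sum_congr rfl fun v _ => ?_
    rw [sum_comm (s := (univ : Finset ι))]
    simp [Complex.mul_re]
  rw [h]
  exact sum_nonneg fun k _ => add_nonneg (hq _) (hq _)

end Matrix

/-- The handshake lemma over `ℝ`, for an arbitrary `Fintype` instance on the edge set. -/
lemma SimpleGraph.sum_degree_cast_eq_two_mul_card_edgeFinset {V : Type*} [Fintype V]
    (G : SimpleGraph V) [DecidableRel G.Adj] [Fintype G.edgeSet] :
    ∑ v, (G.degree v : ℝ) = 2 * G.edgeFinset.card := by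
  classical
  have h := G.sum_degrees_eq_twice_card_edges
  rw [Subsingleton.elim G.fintypeEdgeSet ‹Fintype G.edgeSet›] at h
  exact_mod_cast h

/-- The sum of the entrywise product of a shifted signless Laplacian with a matrix vanishing on
edges and equal to one on the diagonal. -/
lemma SimpleGraph.sum_signlessLaplacian_sub_mul {V : Type*} [Fintype V] [DecidableEq V]
    (G : SimpleGraph V) [DecidableRel G.Adj] [Fintype G.edgeSet] (δ a b : ℝ) (S : V → V → ℝ)
    (hdiag : ∀ v, S v v = 1) (hadj : ∀ v w, G.Adj v w → S v w = 0) :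
    ∑ v, ∑ w, (diagonal (fun v => (G.degree v : ℝ)) + G.adjMatrix ℝ -
        algebraMap ℝ (Matrix V V ℝ) δ) v w * (a * S v w - b) =
      a * (2 * G.edgeFinset.card - Fintype.card V * δ) -
        b * (4 * G.edgeFinset.card - Fintype.card V * δ) := by
  have hdeg := G.sum_degree_cast_eq_two_mul_card_edgeFinset
  have hrow (v : V) : ∑ w, (diagonal (fun v => (G.degree v : ℝ)) + G.adjMatrix ℝ -
      algebraMap ℝ (Matrix V V ℝ) δ) v w * (a * S v w - b) =
      (G.degree v - δ) * (a - b) - b * G.degree v := by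
    have hterm (w : V) : (diagonal (fun v => (G.degree v : ℝ)) + G.adjMatrix ℝ -
        algebraMap ℝ (Matrix V V ℝ) δ) v w * (a * S v w - b) =
        (if v = w then (G.degree v - δ) * (a - b) else 0) - b * G.adjMatrix ℝ v w := by
      by_cases hvw : v = w
      · subst hvw
        simp [Matrix.algebraMap_matrix_apply, hdiag]
      · by_cases h : G.Adj v w <;>
          simp [Matrix.algebraMap_matrix_apply, hvw, h, hadj]
    have hA : ∑ w, G.adjMatrix ℝ v w = G.degree v := by
      simpa [Matrix.mulVec, dotProduct] using G.adjMatrix_mulVec_const_apply (a := (1 : ℝ)) (v := v)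
    simp only [hterm, sum_sub_distrib, ← mul_sum, hA, sum_ite_eq, mem_univ, if_true]
  simp only [hrow, sum_sub_distrib, ← sum_mul, ← mul_sum, hdeg, sum_const, card_univ, nsmul_eq_mul]
  ring

/-- If every one of two families sums to `y`, then centring the rescaled families at `y` gives
the following sum of inner products. -/
lemma sum_star_smul_sub_dotProduct {ι κ : Type*} [Fintype ι] [Fintype κ] (u v : κ → ι → ℂ)
    (y : ι → ℂ) (hu : ∑ i, u i = y) (hv : ∑ i, v i = y) (c : ℕ) (hc : Fintype.card κ = c) :
    ∑ i, star ((c : ℂ) • u i - y) ⬝ᵥ ((c : ℂ) • v i - y) =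
      c ^ 2 * ∑ i, star (u i) ⬝ᵥ v i - c * (star y ⬝ᵥ y) := by
  have h₁ : ∑ i, star (u i) ⬝ᵥ y = star y ⬝ᵥ y := by
    rw [← sum_dotProduct, ← star_sum, hu]
  have h₂ : ∑ i, star y ⬝ᵥ v i = star y ⬝ᵥ y := by
    rw [← dotProduct_sum, hv]
  simp only [star_sub, star_smul, sub_dotProduct, dotProduct_sub, smul_dotProduct, dotProduct_smul,
    star_natCast, smul_eq_mul, sum_sub_distrib, ← mul_sum, h₁, h₂, sum_const, card_univ, hc,
    nsmul_eq_mul]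
  ring

/-- Lima-type bound for the vectorial chromatic number: if `G` has `n` vertices and
`m ≥ 1` edges, `δₙ` is the least eigenvalue of the signless Laplacian `Q = D + A`,
and `G` admits a vectorial `c`-coloring, then `2m ≤ (c-1)·(2m - n·δₙ)`, equivalently
`1 + 2m/(2m - n·δₙ) ≤ c`. -/
theorem lima_bound_vectorial_chromatic_number
    {V : Type*} [Fintype V] [DecidableEq V] (G : SimpleGraph V) [DecidableRel G.Adj]
    [Fintype G.edgeSet]
    (m : ℕ) (hm : m = G.edgeFinset.card) (hm1 : 1 ≤ m)
    (Q : Matrix V V ℝ)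
    (hQdef : Q = Matrix.diagonal (fun v => (G.degree v : ℝ)) + SimpleGraph.adjMatrix ℝ G)
    (hQ : Q.IsHermitian)
    (c d : ℕ) (x : V → Fin c → Fin d → ℂ) (y : Fin d → ℂ)
    (h1 : ∀ v w : V, ∀ i j : Fin c, 0 ≤ star (x v i) ⬝ᵥ x w j)
    (h2 : ∀ v : V, ∑ i, x v i = y)
    (hy : star y ⬝ᵥ y = 1)
    (h3 : ∀ v : V, ∀ i j : Fin c, i ≠ j → star (x v i) ⬝ᵥ x v j = 0)
    (h4 : ∀ v w : V, G.Adj v w → ∀ i : Fin c, star (x v i) ⬝ᵥ x w i = 0) :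
    (2 * m : ℝ) ≤ ((c : ℝ) - 1) * (2 * m - (Fintype.card V : ℝ) * ⨅ i, hQ.eigenvalues i) ∧
      1 + (2 * m : ℝ) / (2 * m - (Fintype.card V : ℝ) * ⨅ i, hQ.eigenvalues i) ≤ (c : ℝ) := by
  subst hm hQdef
  have : Nonempty V := by
    obtain ⟨e, -⟩ := card_pos.1 hm1
    exact ⟨e.out.1⟩
  have hc : 0 < c := by
    refine Nat.pos_of_ne_zero fun hc => ?_
    subst hc
    obtain ⟨v⟩ := this
    simp [← h2 v] at hy
  have hc' : (0 : ℝ) < c := by exact_mod_cast hc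
  have hm0 : (0 : ℝ) < G.edgeFinset.card := by exact_mod_cast hm1
  have hP := hQ.posSemidef_sub_iInf_eigenvalues
  set δ := ⨅ i, hQ.eigenvalues i
  set S : V → V → ℝ := fun v w => (∑ i, star (x v i) ⬝ᵥ x w i).re with hS
  have hdiag (v : V) : S v v = 1 := by
    have h : ∑ i, star (x v i) ⬝ᵥ x v i = star y ⬝ᵥ y := by
      nth_rw 1 [← h2 v]
      rw [star_sum, sum_dotProduct]
      refine sum_congr rfl fun i _ => ?_
      rw [← h2 v, dotProduct_sum]
      exact (sum_eq_single i (fun j _ hj => h3 v i j hj.symm) (by simp)).symm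
    simp only [hS, h, hy, Complex.one_re]
  have hadj (v w : V) (h : G.Adj v w) : S v w = 0 := by
    simp [hS, h4 v w h]
  have hgram (v w : V) : ∑ i, (star ((c : ℂ) • x v i - y) ⬝ᵥ ((c : ℂ) • x w i - y)).re =
      (c : ℝ) ^ 2 * S v w - c := by
    rw [← Complex.re_sum, sum_star_smul_sub_dotProduct _ _ y (h2 v) (h2 w) c (by simp), hy]
    have h : ((c : ℂ) ^ 2) = ((c ^ 2 : ℝ) : ℂ) := by push_cast; rfl
    rw [h, Complex.sub_re, Complex.re_ofReal_mul]
    simp [hS]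
  have hsum := sum_nonneg fun i (_ : i ∈ (univ : Finset (Fin c))) =>
    hP.sum_mul_re_dotProduct_nonneg fun v => (c : ℂ) • x v i - y
  rw [sum_comm] at hsum
  simp only [sum_comm (s := (univ : Finset (Fin c))), ← mul_sum, hgram] at hsum
  rw [G.sum_signlessLaplacian_sub_mul δ _ _ S hdiag hadj] at hsum
  have hnonneg := hP.trace_nonneg
  have htrace : (diagonal (fun v => (G.degree v : ℝ)) + G.adjMatrix ℝ -
      algebraMap ℝ (Matrix V V ℝ) δ).trace = 2 * G.edgeFinset.card - Fintype.card V * δ := by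
    simp [Matrix.trace_sub, Matrix.trace_add, Matrix.algebraMap_eq_diagonal,
      G.sum_degree_cast_eq_two_mul_card_edgeFinset]
  rw [htrace] at hnonneg
  have hmain : (2 * G.edgeFinset.card : ℝ) ≤
      (c - 1) * (2 * G.edgeFinset.card - Fintype.card V * δ) := by
    refine le_of_mul_le_mul_left ?_ hc'
    linarith
  refine ⟨hmain, ?_⟩
  have hpos : (0 : ℝ) < 2 * G.edgeFinset.card - Fintype.card V * δ := by
    refine hnonneg.lt_of_ne fun h => ?_
    rw [← h] at hmain
    linarith
  rw [← le_sub_iff_add_le', div_le_iff₀ hpos]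
  exact hmain
end

section
/- Kolotilina-type bound for the vectorial chromatic number: let G be a finite simple graph with at least one edge, largest adjacency eigenvalue μ₁, largest signless Laplacian eigenvalue δ₁ and largest Laplacian eigenvalue θ₁. If G admits a vectorial c-coloring, then μ₁ ≤ (c − 1)·(μ₁ − δ₁ + θ₁); equivalently, 1 + μ₁/(μ₁ − δ₁ + θ₁) ≤ c, so 1 + μ₁/(μ₁ − δ₁ + θ₁) ≤ χ_vect(G). -/
open Matrix Finset
open scoped ComplexOrder

/-- The Rayleigh quotient of a real symmetric matrix is at most its largest eigenvalue. -/
theorem Matrix.IsHermitian.dotProduct_mulVec_le_iSup_eigenvalues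
    {V : Type*} [Fintype V] [DecidableEq V] {H : Matrix V V ℝ} (hH : H.IsHermitian)
    (f : V → ℝ) :
    f ⬝ᵥ (H *ᵥ f) ≤ (⨆ i, hH.eigenvalues i) * (f ⬝ᵥ f) := by
  set b := hH.eigenvectorBasis
  set g : EuclideanSpace ℝ V := WithLp.toLp 2 f
  have hself : f ⬝ᵥ f = ∑ i, inner ℝ g (b i) * inner ℝ (b i) g := by
    rw [b.sum_inner_mul_inner, EuclideanSpace.inner_eq_star_dotProduct]
    simp [g]
  have hquad : f ⬝ᵥ (H *ᵥ f) =
      ∑ i, hH.eigenvalues i * (inner ℝ g (b i) * inner ℝ (b i) g) := by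
    have hin : f ⬝ᵥ (H *ᵥ f) = inner ℝ g (WithLp.toLp 2 (H *ᵥ f) : EuclideanSpace ℝ V) := by
      rw [EuclideanSpace.inner_eq_star_dotProduct, dotProduct_comm]
      simp [g]
    rw [hin, ← b.sum_inner_mul_inner]
    refine Finset.sum_congr rfl fun i _ => ?_
    have hcoef : inner ℝ (b i) (WithLp.toLp 2 (H *ᵥ f) : EuclideanSpace ℝ V) =
        hH.eigenvalues i * inner ℝ (b i) g := by
      simp only [EuclideanSpace.inner_eq_star_dotProduct, star_trivial, g]
      have hsymm : Hᵀ = H := by simpa [conjTranspose_eq_transpose_of_trivial] using hH.eq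
      rw [dotProduct_comm, dotProduct_mulVec, ← mulVec_transpose, hsymm,
        hH.mulVec_eigenvectorBasis, smul_dotProduct, dotProduct_comm f, smul_eq_mul]
    rw [hcoef]
    ring
  rw [hself, hquad, Finset.mul_sum]
  refine Finset.sum_le_sum fun i _ => ?_
  refine mul_le_mul_of_nonneg_right (le_ciSup (Set.finite_range _).bddAbove i) ?_
  rw [real_inner_comm]
  exact mul_self_nonneg _

/-- The largest eigenvalue of a real symmetric matrix is attained at a unit vector. -/
theorem Matrix.IsHermitian.exists_dotProduct_mulVec_eq_iSup_eigenvalues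
    {V : Type*} [Fintype V] [DecidableEq V] [Nonempty V] {H : Matrix V V ℝ}
    (hH : H.IsHermitian) :
    ∃ z : V → ℝ, z ⬝ᵥ z = 1 ∧ z ⬝ᵥ (H *ᵥ z) = ⨆ i, hH.eigenvalues i := by
  obtain ⟨i, hi⟩ := exists_eq_ciSup_of_finite (f := hH.eigenvalues)
  have hunit : (hH.eigenvectorBasis i : V → ℝ) ⬝ᵥ hH.eigenvectorBasis i = 1 := by
    have h := hH.eigenvectorBasis.inner_eq_one i
    rwa [EuclideanSpace.inner_eq_star_dotProduct, star_trivial] at h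
  refine ⟨hH.eigenvectorBasis i, hunit, ?_⟩
  rw [hH.mulVec_eigenvectorBasis, dotProduct_smul, hunit, hi, smul_eq_mul, mul_one]

theorem dotProduct_mulVec_eq_sum_sum {V R : Type*} [Fintype V] [CommSemiring R]
    (H : Matrix V V R) (f : V → R) :
    f ⬝ᵥ (H *ᵥ f) = ∑ v, ∑ w, H v w * (f v * f w) := by
  simp only [dotProduct, mulVec, Finset.mul_sum]
  exact Finset.sum_congr rfl fun v _ => Finset.sum_congr rfl fun w _ => by ring

/-- Schur product form of the Rayleigh bound, for a Gram matrix of real vectors. -/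
theorem Matrix.IsHermitian.sum_mul_real_gram_le
    {V τ : Type*} [Fintype V] [DecidableEq V] [Fintype τ]
    {H : Matrix V V ℝ} (hH : H.IsHermitian) (z : V → ℝ) (r : τ → V → ℝ) :
    ∑ v, ∑ w, H v w * (z v * z w * ∑ t, r t v * r t w) ≤
      (⨆ i, hH.eigenvalues i) * ∑ v, z v * z v * ∑ t, r t v * r t v := by
  calc ∑ v, ∑ w, H v w * (z v * z w * ∑ t, r t v * r t w)
      = ∑ t, (fun v => z v * r t v) ⬝ᵥ (H *ᵥ fun v => z v * r t v) := by
        simp only [dotProduct_mulVec_eq_sum_sum, Finset.mul_sum]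
        rw [Finset.sum_comm (s := (univ : Finset τ))]
        refine Finset.sum_congr rfl fun v _ => ?_
        rw [Finset.sum_comm (s := (univ : Finset τ))]
        exact Finset.sum_congr rfl fun w _ => Finset.sum_congr rfl fun t _ => by ring
    _ ≤ ∑ t, (⨆ i, hH.eigenvalues i) * ((fun v => z v * r t v) ⬝ᵥ fun v => z v * r t v) :=
        Finset.sum_le_sum fun t _ => hH.dotProduct_mulVec_le_iSup_eigenvalues _
    _ = (⨆ i, hH.eigenvalues i) * ∑ v, z v * z v * ∑ t, r t v * r t v := by
        simp only [dotProduct, Finset.mul_sum]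
        rw [Finset.sum_comm (s := (univ : Finset τ))]
        exact Finset.sum_congr rfl fun v _ => Finset.sum_congr rfl fun t _ => by ring

/-- Schur product form of the Rayleigh bound, for a Gram matrix of complex vectors. -/
theorem Matrix.IsHermitian.sum_mul_gram_le
    {V ι κ : Type*} [Fintype V] [DecidableEq V] [Fintype ι] [Fintype κ]
    {H : Matrix V V ℝ} (hH : H.IsHermitian) (z : V → ℝ) (u : V → ι → κ → ℂ) :
    ∑ v, ∑ w, H v w * (z v * z w * (∑ i, star (u v i) ⬝ᵥ u w i).re) ≤
      (⨆ i, hH.eigenvalues i) * ∑ v, z v * z v * (∑ i, star (u v i) ⬝ᵥ u v i).re := by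
  let r : (ι × κ) ⊕ (ι × κ) → V → ℝ :=
    Sum.elim (fun t v => (u v t.1 t.2).re) (fun t v => (u v t.1 t.2).im)
  have hgram : ∀ v w, (∑ i, star (u v i) ⬝ᵥ u w i).re = ∑ t, r t v * r t w := by
    intro v w
    simp [r, dotProduct, Complex.re_sum, Complex.mul_re, Fintype.sum_prod_type,
      Finset.sum_add_distrib]
  simp only [hgram]
  exact hH.sum_mul_real_gram_le z r

/-- The Gram sums of the centred vectors `c • x v i - y` of a family with `∑ i, x v i = y`. -/
theorem sum_star_centred_dotProduct_centred
    {V : Type*} {c d : ℕ} {x : V → Fin c → Fin d → ℂ} {y : Fin d → ℂ}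
    (h2 : ∀ v : V, ∑ i, x v i = y) (hy : star y ⬝ᵥ y = 1) (v w : V) :
    ∑ i, star ((c : ℂ) • x v i - y) ⬝ᵥ ((c : ℂ) • x w i - y) =
      (c : ℂ) ^ 2 * ∑ i, star (x v i) ⬝ᵥ x w i - c := by
  have hleft : ∑ i, star (x v i) ⬝ᵥ y = 1 := by
    rw [← sum_dotProduct, ← star_sum, h2, hy]
  have hright : ∑ i, star y ⬝ᵥ x w i = 1 := by
    rw [← dotProduct_sum, h2, hy]
  have hterm : ∀ i, star ((c : ℂ) • x v i - y) ⬝ᵥ ((c : ℂ) • x w i - y) =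
      (c : ℂ) ^ 2 * (star (x v i) ⬝ᵥ x w i) - c * (star (x v i) ⬝ᵥ y)
        - c * (star y ⬝ᵥ x w i) + 1 := by
    intro i
    simp only [star_sub, star_smul, star_natCast, sub_dotProduct, dotProduct_sub,
      smul_dotProduct, dotProduct_smul, smul_eq_mul, hy]
    ring
  simp only [hterm, Finset.sum_add_distrib, Finset.sum_sub_distrib, ← Finset.mul_sum, hleft,
    hright, Finset.sum_const, Finset.card_univ, Fintype.card_fin, nsmul_eq_mul]
  ring

theorem kolotilina_bound_vectorial_chromatic_number
    {V : Type*} [Fintype V] [DecidableEq V] (G : SimpleGraph V) [DecidableRel G.Adj]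
    (hedge : ∃ v w, G.Adj v w)
    (hA : (SimpleGraph.adjMatrix ℝ G).IsHermitian)
    (Q L : Matrix V V ℝ)
    (hQdef : Q = Matrix.diagonal (fun v => (G.degree v : ℝ)) + SimpleGraph.adjMatrix ℝ G)
    (hLdef : L = Matrix.diagonal (fun v => (G.degree v : ℝ)) - SimpleGraph.adjMatrix ℝ G)
    (hQ : Q.IsHermitian) (hL : L.IsHermitian)
    (c d : ℕ) (x : V → Fin c → Fin d → ℂ) (y : Fin d → ℂ)
    (h1 : ∀ v w : V, ∀ i j : Fin c, 0 ≤ star (x v i) ⬝ᵥ x w j)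
    (h2 : ∀ v : V, ∑ i, x v i = y)
    (hy : star y ⬝ᵥ y = 1)
    (h3 : ∀ v : V, ∀ i j : Fin c, i ≠ j → star (x v i) ⬝ᵥ x v j = 0)
    (h4 : ∀ v w : V, G.Adj v w → ∀ i : Fin c, star (x v i) ⬝ᵥ x w i = 0) :
    (⨆ i, hA.eigenvalues i) ≤
        ((c : ℝ) - 1) *
          ((⨆ i, hA.eigenvalues i) - (⨆ i, hQ.eigenvalues i) + ⨆ i, hL.eigenvalues i) ∧
      1 + (⨆ i, hA.eigenvalues i) /
          ((⨆ i, hA.eigenvalues i) - (⨆ i, hQ.eigenvalues i) + ⨆ i, hL.eigenvalues i) ≤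
        (c : ℝ) := by
  obtain ⟨a, b, hab⟩ := hedge
  have : Nonempty V := ⟨a⟩
  have hc : (2 : ℝ) ≤ c := by
    rcases c with _ | _ | c
    · have h := h2 a
      simp only [univ_eq_empty, sum_empty] at h
      simp [← h] at hy
    · have ha := h2 a
      have hb := h2 b
      have h := h4 a b hab 0
      rw [Fin.sum_univ_one] at ha hb
      rw [ha, hb, hy] at h
      exact absurd h one_ne_zero
    · push_cast
      linarith [(Nat.cast_nonneg c : (0 : ℝ) ≤ c)]
  have hdiag : ∀ v, ∑ i, star (x v i) ⬝ᵥ x v i = 1 := by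
    intro v
    rw [← hy]
    conv_rhs => rw [← h2 v, star_sum, sum_dotProduct]
    refine Finset.sum_congr rfl fun i _ => ?_
    rw [dotProduct_sum, Finset.sum_eq_single i (fun j _ hj => h3 v i j hj.symm) (by simp)]
  set N : V → V → ℝ := fun v w =>
    (∑ i, star ((c : ℂ) • x v i - y) ⬝ᵥ ((c : ℂ) • x w i - y)).re with hN
  have hN_diag : ∀ v, N v v = c * (c - 1) := by
    intro v
    simp only [hN, sum_star_centred_dotProduct_centred h2 hy, hdiag]
    rw [show (c : ℂ) ^ 2 * 1 - c = ((c * (c - 1) : ℝ) : ℂ) by push_cast; ring,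
      Complex.ofReal_re]
  have hN_adj : ∀ v w, G.Adj v w → N v w = -c := by
    intro v w hvw
    simp only [hN, sum_star_centred_dotProduct_centred h2 hy,
      Finset.sum_eq_zero fun i _ => h4 v w hvw i]
    simp
  obtain ⟨z, hz, hzQ⟩ := hQ.exists_dotProduct_mulVec_eq_iSup_eigenvalues
  have hzL := hL.sum_mul_gram_le z fun v i => (c : ℂ) • x v i - y
  have hzA := hA.dotProduct_mulVec_le_iSup_eigenvalues z
  have hone := hA.dotProduct_mulVec_le_iSup_eigenvalues 1
  set μ := ⨆ i, hA.eigenvalues i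
  set δ := ⨆ i, hQ.eigenvalues i
  set θ := ⨆ i, hL.eigenvalues i
  set S := z ⬝ᵥ (G.adjMatrix ℝ *ᵥ z) with hS
  set T := z ⬝ᵥ (diagonal (fun v => (G.degree v : ℝ)) *ᵥ z) with hT
  rw [hz, mul_one] at hzA
  rw [hQdef, add_mulVec, dotProduct_add] at hzQ
  have hleft : ∑ v, ∑ w, L v w * (z v * z w * N v w) = c * (c - 1) * T + c * S := by
    rw [hS, hT, dotProduct_mulVec_eq_sum_sum, dotProduct_mulVec_eq_sum_sum, Finset.mul_sum,
      Finset.mul_sum, ← Finset.sum_add_distrib]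
    refine Finset.sum_congr rfl fun v _ => ?_
    rw [Finset.mul_sum, Finset.mul_sum, ← Finset.sum_add_distrib]
    refine Finset.sum_congr rfl fun w _ => ?_
    rw [hLdef, Matrix.sub_apply, SimpleGraph.adjMatrix_apply]
    by_cases hvw : v = w
    · subst hvw
      simp only [diagonal_apply_eq, SimpleGraph.irrefl, if_false, hN_diag]
      ring
    · by_cases hadj : G.Adj v w
      · simp only [diagonal_apply_ne _ hvw, if_pos hadj, hN_adj v w hadj]
        ring
      · simp [diagonal_apply_ne _ hvw, hadj]
  have hright : ∑ v, z v * z v * N v v = c * (c - 1) := by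
    simp only [hN_diag, ← Finset.sum_mul]
    rw [show ∑ v, z v * z v = 1 from hz, one_mul]
  have hbound : c * (c - 1) * T + c * S ≤ θ * (c * (c - 1)) := by
    rw [← hleft, ← hright]
    exact hzL
  have hbound' : (c - 1) * T + S ≤ θ * (c - 1) := by
    refine le_of_mul_le_mul_left ?_ (by linarith : (0 : ℝ) < c)
    linarith
  have hmain : μ ≤ (c - 1) * (μ - δ + θ) := by
    nlinarith [mul_le_mul_of_nonneg_left hzA (sub_nonneg.mpr hc)]
  have hμ : 0 < μ := by
    rw [dotProduct_mulVec_eq_sum_sum] at hone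
    have hpos : 0 < ∑ v, ∑ w, G.adjMatrix ℝ v w * ((1 : V → ℝ) v * (1 : V → ℝ) w) := by
      have hnonneg : ∀ v w, 0 ≤ G.adjMatrix ℝ v w * ((1 : V → ℝ) v * (1 : V → ℝ) w) := by
        intro v w
        simp only [SimpleGraph.adjMatrix_apply, Pi.one_apply, mul_one]
        split_ifs <;> norm_num
      refine Finset.sum_pos' (fun v _ => Finset.sum_nonneg fun w _ => hnonneg v w)
        ⟨a, mem_univ a, Finset.sum_pos' (fun w _ => hnonneg a w) ⟨b, mem_univ b, ?_⟩⟩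
      simp [SimpleGraph.adjMatrix_apply, hab]
    refine pos_of_mul_pos_left (hpos.trans_le hone) ?_
    simp
  have hden : 0 < μ - δ + θ :=
    pos_of_mul_pos_right (hμ.trans_le hmain) (by linarith)
  refine ⟨hmain, ?_⟩
  have hdiv := (div_le_iff₀ hden).mpr hmain
  linarith
end

section
/- Spectral lower bounds for the orthogonal rank: let G be a finite simple graph with at least one edge. If G admits an orthogonal representation in dimension d, then d ≥ 1 + max( μ₁/|μₙ| , 2m/(2m − n·δₙ) , μ₁/(μ₁ − δ₁ + θ₁) ); in particular these three spectral quantities are lower bounds for the orthogonal rank ξ(G). -/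
open Matrix Finset

lemma Matrix.IsHermitian.dotProduct_mulVec_eq_sum_eigenvalues {V : Type*} [Fintype V]
    [DecidableEq V] {S : Matrix V V ℝ} (hS : S.IsHermitian) (y : V → ℝ) :
    y ⬝ᵥ S *ᵥ y = ∑ i, hS.eigenvalues i * (y ⬝ᵥ (hS.eigenvectorBasis i : V → ℝ)) ^ 2 := by
  have h := hS.eigenvectorBasis.sum_inner_mul_inner (WithLp.toLp 2 y) (WithLp.toLp 2 (S *ᵥ y))
  have h1 : inner ℝ (WithLp.toLp 2 y) (WithLp.toLp 2 (S *ᵥ y)) = y ⬝ᵥ S *ᵥ y := by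
    simp [EuclideanSpace.inner_eq_star_dotProduct, dotProduct_comm]
  rw [← h1, ← h]
  refine Finset.sum_congr rfl fun i _ => ?_
  have hT : Sᵀ = S := by simpa [IsSymm] using hS
  have h2 : (S *ᵥ y) ⬝ᵥ (hS.eigenvectorBasis i : V → ℝ)
      = hS.eigenvalues i * (y ⬝ᵥ (hS.eigenvectorBasis i : V → ℝ)) := by
    rw [dotProduct_comm, dotProduct_mulVec, ← mulVec_transpose, hT, hS.mulVec_eigenvectorBasis,
      smul_dotProduct, dotProduct_comm, smul_eq_mul]
  simp only [EuclideanSpace.inner_eq_star_dotProduct, star_trivial]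
  rw [h2, dotProduct_comm _ y]
  ring

lemma Matrix.IsHermitian.dotProduct_self_eq_sum {V : Type*} [Fintype V]
    [DecidableEq V] {S : Matrix V V ℝ} (hS : S.IsHermitian) (y : V → ℝ) :
    y ⬝ᵥ y = ∑ i, (y ⬝ᵥ (hS.eigenvectorBasis i : V → ℝ)) ^ 2 := by
  have h := hS.eigenvectorBasis.sum_inner_mul_inner (WithLp.toLp 2 y) (WithLp.toLp 2 y)
  simp only [EuclideanSpace.inner_eq_star_dotProduct, star_trivial] at h
  rw [← h]
  refine Finset.sum_congr rfl fun i _ => ?_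
  rw [dotProduct_comm _ y]
  ring

lemma Matrix.IsHermitian.iInf_eigenvalues_mul_le {V : Type*} [Fintype V]
    [DecidableEq V] {S : Matrix V V ℝ} (hS : S.IsHermitian) (y : V → ℝ) :
    (⨅ i, hS.eigenvalues i) * (y ⬝ᵥ y) ≤ y ⬝ᵥ S *ᵥ y := by
  rw [hS.dotProduct_mulVec_eq_sum_eigenvalues, hS.dotProduct_self_eq_sum, Finset.mul_sum]
  gcongr with i
  exact ciInf_le (Set.finite_range _).bddBelow i

lemma Matrix.IsHermitian.le_iSup_eigenvalues_mul {V : Type*} [Fintype V]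
    [DecidableEq V] {S : Matrix V V ℝ} (hS : S.IsHermitian) (y : V → ℝ) :
    y ⬝ᵥ S *ᵥ y ≤ (⨆ i, hS.eigenvalues i) * (y ⬝ᵥ y) := by
  rw [hS.dotProduct_mulVec_eq_sum_eigenvalues, hS.dotProduct_self_eq_sum, Finset.mul_sum]
  gcongr with i
  exact le_ciSup (Set.finite_range _).bddAbove i

lemma Matrix.IsHermitian.exists_dotProduct_mulVec_eq_iSup {V : Type*} [Fintype V] [Nonempty V]
    [DecidableEq V] {S : Matrix V V ℝ} (hS : S.IsHermitian) :
    ∃ z : V → ℝ, z ⬝ᵥ z = 1 ∧ z ⬝ᵥ S *ᵥ z = ⨆ i, hS.eigenvalues i := by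
  obtain ⟨i, hi⟩ := exists_eq_ciSup_of_finite (f := hS.eigenvalues)
  have h1 : (hS.eigenvectorBasis i : V → ℝ) ⬝ᵥ (hS.eigenvectorBasis i : V → ℝ) = 1 := by
    have := hS.eigenvectorBasis.inner_eq_one i
    simpa only [EuclideanSpace.inner_eq_star_dotProduct, star_trivial] using this
  refine ⟨hS.eigenvectorBasis i, h1, ?_⟩
  rw [hS.mulVec_eigenvectorBasis, dotProduct_smul, h1, hi, smul_eq_mul, mul_one]

open scoped ComplexOrder in
/-- Up to a factor `d`, the real coordinates of the traceless part of the rank-one projections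
onto the lines spanned by the `x v`. -/
lemma exists_real_vectors_of_orthogonal_representation {V : Type*} (G : SimpleGraph V)
    (d : ℕ) (hd : 0 < d) (x : V → Fin d → ℂ) (hx : ∀ v, x v ≠ 0)
    (horth : ∀ v w, G.Adj v w → star (x v) ⬝ᵥ x w = 0) :
    ∃ f : V → (Fin d × Fin d) ⊕ (Fin d × Fin d) → ℝ,
      (∀ v, f v ⬝ᵥ f v = d * (d - 1)) ∧ ∀ v w, G.Adj v w → f v ⬝ᵥ f w = -d := by
  have hd' : (d : ℂ) ≠ 0 := by exact_mod_cast hd.ne'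
  have hs : ∀ v, star (x v) ⬝ᵥ x v ≠ 0 := fun v => by
    simpa only [ne_eq, dotProduct_star_self_eq_zero] using hx v
  set F : V → Fin d → Fin d → ℂ := fun v i j =>
    d * (x v i * star (x v j)) / (star (x v) ⬝ᵥ x v) - if i = j then 1 else 0 with hF
  have hsr : ∀ v, star (star (x v) ⬝ᵥ x v) = star (x v) ⬝ᵥ x v := fun v => by
    rw [star_dotProduct, star_star, dotProduct_comm]
    simp [dotProduct, mul_comm]
  have hinner : ∀ v w, ∑ i, ∑ j, star (F v i j) * F w i j
      = d ^ 2 * ((star (x v) ⬝ᵥ x w) * (star (x w) ⬝ᵥ x v)) /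
        ((star (x v) ⬝ᵥ x v) * (star (x w) ⬝ᵥ x w)) - d := by
    intro v w
    have hstar : ∀ i j, star (F v i j) = d * (star (x v i) * x v j) / (star (x v) ⬝ᵥ x v)
        - if i = j then 1 else 0 := by
      intro i j
      simp only [hF, star_sub, star_div₀, hsr, star_mul', star_star, star_natCast]
      split_ifs <;> simp
    have hterm : ∀ i j, star (F v i j) * F w i j =
        d ^ 2 / ((star (x v) ⬝ᵥ x v) * (star (x w) ⬝ᵥ x w)) *
          ((star (x v i) * x w i) * (star (x w j) * x v j))
        - (if i = j then d / (star (x v) ⬝ᵥ x v) * (star (x v i) * x v i) else 0)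
        - (if i = j then d / (star (x w) ⬝ᵥ x w) * (star (x w i) * x w i) else 0)
        + if i = j then 1 else 0 := by
      intro i j
      rw [hstar]
      simp only [hF]
      have := hs v
      have := hs w
      split_ifs with hij
      · subst hij
        field_simp
        ring
      · field_simp
        ring
    simp only [hterm, Finset.sum_add_distrib, Finset.sum_sub_distrib, Finset.sum_ite_eq,
      Finset.mem_univ, if_true, ← Finset.mul_sum, ← Finset.sum_mul]
    have e : ∀ a b, ∑ i, star (x a i) * x b i = star (x a) ⬝ᵥ x b := fun a b => rfl
    simp only [e]
    have := hs v
    have := hs w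
    simp
    field_simp
    ring
  refine ⟨fun v => Sum.elim (fun p => (F v p.1 p.2).re) (fun p => (F v p.1 p.2).im), ?_⟩
  have hre : ∀ v w, (Sum.elim (fun p : Fin d × Fin d => (F v p.1 p.2).re)
      (fun p : Fin d × Fin d => (F v p.1 p.2).im)) ⬝ᵥ
      (Sum.elim (fun p : Fin d × Fin d => (F w p.1 p.2).re)
      (fun p : Fin d × Fin d => (F w p.1 p.2).im)) = (∑ i, ∑ j, star (F v i j) * F w i j).re := by
    intro v w
    simp only [dotProduct, Fintype.sum_sum_type, Sum.elim_inl, Sum.elim_inr,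
      ← Finset.sum_add_distrib, Fintype.sum_prod_type, Complex.re_sum]
    simp
  constructor
  · intro v
    rw [hre, hinner, mul_div_assoc, div_self (mul_ne_zero (hs v) (hs v))]
    simp [pow_two]
    ring
  · intro v w h
    rw [hre, hinner, horth v w h]
    simp

lemma SimpleGraph.rayleigh_bound_of_gram {V ι : Type*} [Fintype V] [DecidableEq V] [Fintype ι]
    (G : SimpleGraph V) [DecidableRel G.Adj] (f : V → ι → ℝ) (a b c : ℝ)
    (hdiag : ∀ v, f v ⬝ᵥ f v = a) (hoff : ∀ v w, G.Adj v w → f v ⬝ᵥ f w = b) (p z : V → ℝ)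
    (hc : ∀ y : V → ℝ, c * (y ⬝ᵥ y) ≤ y ⬝ᵥ (diagonal p + G.adjMatrix ℝ) *ᵥ y) :
    c * (a * (z ⬝ᵥ z)) ≤ a * (z ⬝ᵥ diagonal p *ᵥ z) + b * (z ⬝ᵥ G.adjMatrix ℝ *ᵥ z) := by
  have h := Finset.sum_le_sum fun i (_ : i ∈ (univ : Finset ι)) => hc fun v => z v * f v i
  have hd : ∀ q : V → ℝ, ∑ i, ∑ v, q v * ((z v * f v i) * (z v * f v i))
      = a * ∑ v, q v * (z v * z v) := by
    intro q
    rw [Finset.sum_comm, Finset.mul_sum]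
    refine Finset.sum_congr rfl fun v _ => ?_
    rw [← hdiag v, dotProduct, Finset.sum_mul]
    exact Finset.sum_congr rfl fun i _ => by ring
  have h1 : ∑ i, c * ((fun v => z v * f v i) ⬝ᵥ fun v => z v * f v i) = c * (a * (z ⬝ᵥ z)) := by
    rw [← Finset.mul_sum]
    have := hd 1
    simp only [Pi.one_apply, one_mul] at this
    simp only [dotProduct, this]
  have h2 : ∑ i, (fun v => z v * f v i) ⬝ᵥ diagonal p *ᵥ (fun v => z v * f v i)
      = a * (z ⬝ᵥ diagonal p *ᵥ z) := by
    simp only [dotProduct, mulVec_diagonal]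
    have := hd p
    simpa only [mul_left_comm (p _)] using this
  have h3 : ∑ i, (fun v => z v * f v i) ⬝ᵥ G.adjMatrix ℝ *ᵥ (fun v => z v * f v i)
      = b * (z ⬝ᵥ G.adjMatrix ℝ *ᵥ z) := by
    simp only [dotProduct, mulVec, Finset.mul_sum]
    rw [Finset.sum_comm]
    refine Finset.sum_congr rfl fun v _ => ?_
    rw [Finset.sum_comm]
    refine Finset.sum_congr rfl fun w _ => ?_
    by_cases hvw : G.Adj v w
    · rw [← hoff v w hvw, dotProduct, Finset.sum_mul]
      exact Finset.sum_congr rfl fun i _ => by ring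
    · simp [SimpleGraph.adjMatrix_apply, hvw]
  simp only [add_mulVec, dotProduct_add, Finset.sum_add_distrib] at h
  rwa [h1, h2, h3] at h

lemma two_le_of_orthogonal_ne_zero {d : ℕ} {x y : Fin d → ℂ} (hx : x ≠ 0) (hy : y ≠ 0)
    (h : star x ⬝ᵥ y = 0) : 2 ≤ d := by
  by_contra! hd
  interval_cases d
  · exact hx (Subsingleton.elim _ _)
  · simp only [dotProduct, Finset.univ_unique, Finset.sum_singleton, Pi.star_apply,
      mul_eq_zero, star_eq_zero] at h
    rcases h with h | h
    · exact hx (funext fun i => by rwa [Subsingleton.elim i default])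
    · exact hy (funext fun i => by rwa [Subsingleton.elim i default])

/-- Spectral lower bounds for the orthogonal rank: if `G` has an edge and admits an
orthogonal representation in dimension `d`, then
`d ≥ 1 + max(μ₁/|μₙ|, 2m/(2m - n·δₙ), μ₁/(μ₁ - δ₁ + θ₁))`. -/
theorem spectral_lower_bounds_orthogonal_rank
    {V : Type*} [Fintype V] [DecidableEq V] (G : SimpleGraph V) [DecidableRel G.Adj]
    [Fintype G.edgeSet]
    (hedge : ∃ v w, G.Adj v w)
    (hA : (SimpleGraph.adjMatrix ℝ G).IsHermitian)
    (Q L : Matrix V V ℝ)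
    (hQdef : Q = Matrix.diagonal (fun v => (G.degree v : ℝ)) + SimpleGraph.adjMatrix ℝ G)
    (hLdef : L = Matrix.diagonal (fun v => (G.degree v : ℝ)) - SimpleGraph.adjMatrix ℝ G)
    (hQ : Q.IsHermitian) (hL : L.IsHermitian)
    (m : ℕ) (hm : m = G.edgeFinset.card)
    (d : ℕ) (x : V → Fin d → ℂ)
    (hx : ∀ v, x v ≠ 0)
    (horth : ∀ v w, G.Adj v w → star (x v) ⬝ᵥ x w = 0) :
    1 + max (max ((⨆ i, hA.eigenvalues i) / |⨅ i, hA.eigenvalues i|)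
          ((2 * m : ℝ) / (2 * m - (Fintype.card V : ℝ) * ⨅ i, hQ.eigenvalues i)))
        ((⨆ i, hA.eigenvalues i) /
          ((⨆ i, hA.eigenvalues i) - (⨆ i, hQ.eigenvalues i) + ⨆ i, hL.eigenvalues i)) ≤
      (d : ℝ) := by
  obtain ⟨v₀, w₀, hvw⟩ := hedge
  have : Nonempty V := ⟨v₀⟩
  have hd2 : 2 ≤ d := two_le_of_orthogonal_ne_zero (hx v₀) (hx w₀) (horth v₀ w₀ hvw)
  have hd : (2 : ℝ) ≤ d := by exact_mod_cast hd2
  obtain ⟨f, hdiag, hoff⟩ :=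
    exists_real_vectors_of_orthogonal_representation G d (by lia) x hx horth
  have key : ∀ (c : ℝ) (p z : V → ℝ),
      (∀ y : V → ℝ, c * (y ⬝ᵥ y) ≤ y ⬝ᵥ (diagonal p + G.adjMatrix ℝ) *ᵥ y) →
      c * ((d - 1) * (z ⬝ᵥ z)) ≤
        (d - 1) * (z ⬝ᵥ diagonal p *ᵥ z) - z ⬝ᵥ G.adjMatrix ℝ *ᵥ z := by
    intro c p z hc
    have h := G.rayleigh_bound_of_gram f _ _ c hdiag hoff p z hc
    refine le_of_mul_le_mul_left ?_ (by linarith : (0 : ℝ) < d)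
    linarith
  have hμ : 0 ≤ ⨆ i, hA.eigenvalues i := by
    have := hA.le_iSup_eigenvalues_mul (Pi.single v₀ 1)
    simpa using this
  have h1 : (⨆ i, hA.eigenvalues i) ≤ (d - 1) * |⨅ i, hA.eigenvalues i| := by
    obtain ⟨z, hz, hzA⟩ := hA.exists_dotProduct_mulVec_eq_iSup
    have h := key (⨅ i, hA.eigenvalues i) 0 z fun y => by
      simpa using hA.iInf_eigenvalues_mul_le y
    have hn : (d - 1 : ℝ) * -(⨅ i, hA.eigenvalues i) ≤ (d - 1) * |⨅ i, hA.eigenvalues i| :=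
      mul_le_mul_of_nonneg_left (neg_le_abs _) (by linarith)
    have h0 : (diagonal (0 : V → ℝ)) = 0 := diagonal_zero
    rw [hz, hzA, h0, zero_mulVec, dotProduct_zero] at h
    linarith
  have h2 : (2 * m : ℝ) ≤ (d - 1) * (2 * m - (Fintype.card V : ℝ) * ⨅ i, hQ.eigenvalues i) := by
    have h := key (⨅ i, hQ.eigenvalues i) (fun v => (G.degree v : ℝ)) 1 fun y => by
      rw [← hQdef]
      exact hQ.iInf_eigenvalues_mul_le y
    have hdeg : ∑ v, (G.degree v : ℝ) = 2 * m := by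
      rw [hm]
      rw [show G.edgeFinset.card = (@SimpleGraph.edgeFinset V G G.fintypeEdgeSet).card by congr!]
      exact_mod_cast G.sum_degrees_eq_twice_card_edges
    have e1 : (1 : V → ℝ) ⬝ᵥ 1 = Fintype.card V := by simp [dotProduct]
    have e2 : (1 : V → ℝ) ⬝ᵥ diagonal (fun v => (G.degree v : ℝ)) *ᵥ 1 = 2 * m := by
      simp [dotProduct, mulVec_diagonal, hdeg]
    have e3 : (1 : V → ℝ) ⬝ᵥ G.adjMatrix ℝ *ᵥ 1 = 2 * m := by
      rw [← hdeg, dotProduct]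
      simp [SimpleGraph.adjMatrix_mulVec_apply]
    rw [e1, e2, e3] at h
    linarith
  have h3 : (⨆ i, hA.eigenvalues i) ≤ (d - 1) *
      ((⨆ i, hA.eigenvalues i) - (⨆ i, hQ.eigenvalues i) + ⨆ i, hL.eigenvalues i) := by
    obtain ⟨z, hz, hzQ⟩ := hQ.exists_dotProduct_mulVec_eq_iSup
    have h := key (-⨆ i, hL.eigenvalues i) (fun v => -(G.degree v : ℝ)) z fun y => by
      have hneg : diagonal (fun v => -(G.degree v : ℝ)) + G.adjMatrix ℝ = -L := by
        rw [hLdef, ← Matrix.diagonal_neg]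
        abel
      rw [hneg, neg_mulVec, dotProduct_neg, neg_mul]
      exact neg_le_neg (hL.le_iSup_eigenvalues_mul y)
    have hzA := hA.le_iSup_eigenvalues_mul z
    rw [← Matrix.diagonal_neg, neg_mulVec, dotProduct_neg, hz] at h
    have hzDA := congrArg (fun M => z ⬝ᵥ M *ᵥ z) hQdef
    simp only [add_mulVec, dotProduct_add, hzQ] at hzDA
    rw [hz] at hzA
    rw [hzDA]
    nlinarith [mul_le_mul_of_nonneg_left hzA (by linarith : (0 : ℝ) ≤ d - 2)]
  have hd1 : (0 : ℝ) < d - 1 := by linarith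
  have hdiv : ∀ a b : ℝ, 0 ≤ a → a ≤ (d - 1) * b → a / b ≤ d - 1 := fun a b ha hab =>
    div_le_of_le_mul₀ (nonneg_of_mul_nonneg_right (ha.trans hab) hd1) hd1.le hab
  have := max_le (max_le (hdiv _ _ hμ h1) (hdiv _ _ (by positivity) h2)) (hdiv _ _ hμ h3)
  linarith
end

section
/- Inertial lower bound for the projective rank: let G be a finite simple graph on n vertices with inertia (n⁺, n⁰, n⁻). If G admits a d/r-representation, then n·r ≤ (n⁺ + n⁰)·d and n·r ≤ (n⁻ + n⁰)·d; equivalently, d/r ≥ 1 + max( n⁺/(n⁻ + n⁰) , n⁻/(n⁺ + n⁰) ), so this quantity is a lower bound for the projective rank ξ_f(G). -/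
open Matrix Finset

/-- An arrangement of vectors `X v ∈ range (P v)` is totally isotropic for the quadratic form of the
adjacency matrix when the projectors on adjacent vertices are orthogonal. -/
lemma trace_conjTranspose_mul_adjMatrix_mul_eq_zero
    {V : Type*} [Fintype V] (G : SimpleGraph V) [DecidableRel G.Adj]
    {ι : Type*} [Fintype ι] (P : V → Matrix ι ι ℂ)
    (hHerm : ∀ v, (P v).IsHermitian)
    (horth : ∀ v w, G.Adj v w → P v * P w = 0)
    (X : Matrix V ι ℂ) (hX : ∀ v, ∃ z, P v *ᵥ z = X v) :
    (Xᴴ * (SimpleGraph.adjMatrix ℝ G).map Complex.ofReal * X).trace = 0 := by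
  have key : ∀ v w, G.Adj v w → star (X v) ⬝ᵥ X w = 0 := by
    intro v w hvw
    obtain ⟨a, ha⟩ := hX v
    obtain ⟨b, hb⟩ := hX w
    rw [← ha, ← hb, star_mulVec, (hHerm v).eq, ← dotProduct_mulVec, mulVec_mulVec,
      horth v w hvw, zero_mulVec, dotProduct_zero]
  have expand : (Xᴴ * (SimpleGraph.adjMatrix ℝ G).map Complex.ofReal * X).trace =
      ∑ w, ∑ v, (SimpleGraph.adjMatrix ℝ G v w : ℂ) * (star (X v) ⬝ᵥ X w) := by
    simp only [trace, diag_apply, mul_apply, dotProduct, Finset.sum_mul, Finset.mul_sum]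
    rw [Finset.sum_comm]
    refine Finset.sum_congr rfl fun w _ => ?_
    rw [Finset.sum_comm]
    refine Finset.sum_congr rfl fun v _ => Finset.sum_congr rfl fun j _ => ?_
    simp only [conjTranspose_apply, map_apply, Pi.star_apply]
    ring
  rw [expand]
  refine Finset.sum_eq_zero fun w _ => Finset.sum_eq_zero fun v _ => ?_
  by_cases h : G.Adj v w
  · rw [key v w h, mul_zero]
  · simp [h]

/-- The trace of the quadratic form of a diagonal matrix. -/
lemma re_trace_conjTranspose_mul_diagonal_mul
    {V ι : Type*} [Fintype V] [DecidableEq V] [Fintype ι] (μ : V → ℝ) (Y : Matrix V ι ℂ) :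
    (Yᴴ * diagonal (fun i => (μ i : ℂ)) * Y).trace.re =
      ∑ i, μ i * ∑ j, Complex.normSq (Y i j) := by
  simp only [trace, diag_apply, mul_apply (M := _ * _), mul_diagonal, conjTranspose_apply,
    Complex.re_sum, Finset.mul_sum]
  rw [Finset.sum_comm]
  refine Finset.sum_congr rfl fun i _ => Finset.sum_congr rfl fun j _ => ?_
  rw [mul_right_comm, mul_comm, Complex.star_def, ← Complex.normSq_eq_conj_mul_self,
    ← Complex.ofReal_mul, Complex.ofReal_re]

/-- If the eigenvalues outside `S` all have the same strict sign `s`, then `S` indexes a space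
large enough to contain a totally isotropic subspace coming from a projective representation. -/
lemma card_mul_rank_le_of_sign
    {V : Type*} [Fintype V] [DecidableEq V] (G : SimpleGraph V) [DecidableRel G.Adj]
    (hA : (SimpleGraph.adjMatrix ℝ G).IsHermitian)
    {d r : ℕ} (P : V → Matrix (Fin d) (Fin d) ℂ)
    (hHerm : ∀ v, (P v).IsHermitian)
    (hrank : ∀ v, (P v).rank = r)
    (horth : ∀ v w, G.Adj v w → P v * P w = 0)
    (s : ℝ) (S : Finset V) (hS : ∀ i, i ∉ S → 0 < s * hA.eigenvalues i) :
    Fintype.card V * r ≤ S.card * d := by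
  let U₀ : Matrix V V ℝ := hA.eigenvectorUnitary
  let U : Matrix V V ℂ := U₀.map Complex.ofReal
  have hUU₀ : U₀ * U₀ᴴ = 1 := Unitary.mul_star_self_of_mem hA.eigenvectorUnitary.2
  have hmap : U₀ᴴ.map Complex.ofReal = Uᴴ := by
    ext i j
    simp [U]
  have hUU : U * Uᴴ = 1 := by
    rw [← hmap]
    change U₀.map Complex.ofRealHom * U₀ᴴ.map Complex.ofRealHom = 1
    rw [← Matrix.map_mul, hUU₀, Matrix.map_one _ (map_zero _) (map_one _)]
  have hspec : (SimpleGraph.adjMatrix ℝ G).map Complex.ofReal =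
      U * diagonal (fun i => (hA.eigenvalues i : ℂ)) * Uᴴ := by
    have h : SimpleGraph.adjMatrix ℝ G = U₀ * diagonal hA.eigenvalues * U₀ᴴ := by
      have := hA.spectral_theorem
      rwa [Unitary.conjStarAlgAut_apply] at this
    conv_lhs => rw [h]
    rw [← hmap]
    change (U₀ * diagonal hA.eigenvalues * U₀ᴴ).map Complex.ofRealHom =
      U₀.map Complex.ofRealHom * _ * U₀ᴴ.map Complex.ofRealHom
    rw [Matrix.map_mul, Matrix.map_mul, diagonal_map (map_zero _)]
    rfl
  let T : (∀ v, LinearMap.range (P v).mulVecLin) →ₗ[ℂ] (S → Fin d → ℂ) :=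
    { toFun := fun x i => (Uᴴ * Matrix.of fun v => (x v : Fin d → ℂ)) i
      map_add' := fun x y => by
        ext i j
        simp [mul_apply, mul_add, Finset.sum_add_distrib]
      map_smul' := fun c x => by
        ext i j
        simp [mul_apply, Finset.mul_sum, mul_left_comm] }
  have hT : Function.Injective T := by
    rw [← LinearMap.ker_eq_bot, LinearMap.ker_eq_bot']
    intro x hx
    let X : Matrix V (Fin d) ℂ := Matrix.of fun v => (x v : Fin d → ℂ)
    let Y := Uᴴ * X
    have hYS : ∀ i ∈ S, Y i = 0 := fun i hi => congrFun hx ⟨i, hi⟩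
    have htr := trace_conjTranspose_mul_adjMatrix_mul_eq_zero G P hHerm horth X
      fun v => (x v).2
    have hXY : Xᴴ * (SimpleGraph.adjMatrix ℝ G).map Complex.ofReal * X =
        Yᴴ * diagonal (fun i => (hA.eigenvalues i : ℂ)) * Y := by
      simp only [hspec, Y, conjTranspose_mul, conjTranspose_conjTranspose, Matrix.mul_assoc]
    have hsum := re_trace_conjTranspose_mul_diagonal_mul hA.eigenvalues Y
    rw [← hXY, htr, Complex.zero_re] at hsum
    have hsum' : ∑ i, s * hA.eigenvalues i * ∑ j, Complex.normSq (Y i j) = 0 := by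
      simp only [mul_assoc]
      rw [← Finset.mul_sum, ← hsum, mul_zero]
    have hnonneg : ∀ i ∈ univ, 0 ≤ s * hA.eigenvalues i * ∑ j, Complex.normSq (Y i j) := by
      intro i _
      by_cases hi : i ∈ S
      · simp [hYS i hi]
      · exact mul_nonneg (hS i hi).le (Finset.sum_nonneg fun j _ => Complex.normSq_nonneg _)
    have hY : Y = 0 := by
      ext i j
      by_cases hi : i ∈ S
      · simp [hYS i hi]
      · have h := (Finset.sum_eq_zero_iff_of_nonneg hnonneg).1 hsum' i (mem_univ i)
        have h' := (mul_eq_zero.1 h).resolve_left (hS i hi).ne'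
        exact Complex.normSq_eq_zero.1 ((Finset.sum_eq_zero_iff_of_nonneg
          fun j _ => Complex.normSq_nonneg _).1 h' j (mem_univ j))
    have hX : X = 0 := by
      rw [← Matrix.one_mul X, ← hUU, Matrix.mul_assoc]
      change U * Y = 0
      rw [hY, Matrix.mul_zero]
    ext v j
    exact congrFun (congrFun hX v) j
  have hle := LinearMap.finrank_le_finrank_of_injective hT
  have hdom : Module.finrank ℂ (∀ v, LinearMap.range (P v).mulVecLin) = Fintype.card V * r := by
    rw [Module.finrank_pi_fintype]
    have : ∀ v, Module.finrank ℂ (LinearMap.range (P v).mulVecLin) = r := hrank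
    simp [this]
  have hcod : Module.finrank ℂ (S → Fin d → ℂ) = S.card * d := by
    simp [Module.finrank_pi_fintype]
  rwa [hdom, hcod] at hle

/-- Rewriting `(a + b) * r ≤ b * d` as a lower bound for `d / r`. -/
lemma one_add_div_le_div_of_mul_le {a b d r : ℝ} (hb : 0 ≤ b) (hr : 0 < r)
    (hab : 0 < a + b) (h : (a + b) * r ≤ b * d) : 1 + a / b ≤ d / r := by
  have hb' : 0 < b := by
    refine hb.lt_of_ne fun h0 => ?_
    rw [← h0] at h hab
    nlinarith
  rw [one_add_div hb'.ne', div_le_div_iff₀ hb' hr]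
  linarith


/-- Inertial lower bound for the projective rank: if `G` on `n` vertices with inertia
`(n⁺, n⁰, n⁻)` admits a `d/r`-representation, then `n·r ≤ (n⁺ + n⁰)·d` and
`n·r ≤ (n⁻ + n⁰)·d`; equivalently `d/r ≥ 1 + max(n⁺/(n⁻ + n⁰), n⁻/(n⁺ + n⁰))`. -/
theorem inertial_lower_bound_projective_rank
    {V : Type*} [Fintype V] [DecidableEq V] (G : SimpleGraph V) [DecidableRel G.Adj]
    (hA : (SimpleGraph.adjMatrix ℝ G).IsHermitian)
    (nplus nzero nminus : ℕ)
    (hplus : nplus = (univ.filter fun i => 0 < hA.eigenvalues i).card)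
    (hzero : nzero = (univ.filter fun i => hA.eigenvalues i = 0).card)
    (hminus : nminus = (univ.filter fun i => hA.eigenvalues i < 0).card)
    (d r : ℕ) (P : V → Matrix (Fin d) (Fin d) ℂ)
    (hHerm : ∀ v, (P v).IsHermitian)
    (hIdem : ∀ v, P v * P v = P v)
    (hrank : ∀ v, (P v).rank = r)
    (horth : ∀ v w, G.Adj v w → P v * P w = 0) :
    (Fintype.card V * r ≤ (nplus + nzero) * d ∧
        Fintype.card V * r ≤ (nminus + nzero) * d) ∧
      (0 < r → 0 < Fintype.card V →
        1 + max ((nplus : ℝ) / ((nminus : ℝ) + (nzero : ℝ)))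
            ((nminus : ℝ) / ((nplus : ℝ) + (nzero : ℝ))) ≤ (d : ℝ) / (r : ℝ)) := by
  have hcard : nplus + nzero + nminus = Fintype.card V := by
    rw [hplus, hzero, hminus, ← Finset.card_univ, Finset.card_filter, Finset.card_filter,
      Finset.card_filter, ← Finset.sum_add_distrib, ← Finset.sum_add_distrib,
      Finset.card_eq_sum_ones]
    refine Finset.sum_congr rfl fun i _ => ?_
    rcases lt_trichotomy (hA.eigenvalues i) 0 with h | h | h
    · simp [h, h.ne, h.le]
    · simp [h]
    · simp [h, h.ne', h.le]
  have hcompl : ∀ p : V → Prop, [DecidablePred p] →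
      (univ.filter fun i => ¬ p i).card = Fintype.card V - (univ.filter p).card := by
    intro p _
    have := Finset.card_filter_add_card_filter_not (s := (univ : Finset V)) p
    rw [← Finset.card_univ]
    omega
  have h1 : Fintype.card V * r ≤ (nplus + nzero) * d := by
    have h := card_mul_rank_le_of_sign G hA P hHerm hrank horth (-1)
      (univ.filter fun i => ¬ hA.eigenvalues i < 0) (by simp)
    rwa [hcompl, ← hminus, ← hcard, Nat.add_sub_cancel, hcard] at h
  have h2 : Fintype.card V * r ≤ (nminus + nzero) * d := by
    have h := card_mul_rank_le_of_sign G hA P hHerm hrank horth 1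
      (univ.filter fun i => ¬ 0 < hA.eigenvalues i) (by simp)
    rwa [hcompl, ← hplus, show Fintype.card V - nplus = nminus + nzero by omega] at h
  refine ⟨⟨h1, h2⟩, fun hr hV => ?_⟩
  have hr' : (0 : ℝ) < r := by exact_mod_cast hr
  have hV' : (0 : ℝ) < Fintype.card V := by exact_mod_cast hV
  have hcard' : (nplus : ℝ) + nzero + nminus = Fintype.card V := by exact_mod_cast hcard
  have h1' : (Fintype.card V : ℝ) * r ≤ (nplus + nzero) * d := by exact_mod_cast h1
  have h2' : (Fintype.card V : ℝ) * r ≤ (nminus + nzero) * d := by exact_mod_cast h2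
  rw [← max_add_add_left]
  refine max_le ?_ ?_
  · refine one_add_div_le_div_of_mul_le (by positivity) hr' (by linarith) ?_
    rwa [show (nplus : ℝ) + (nminus + nzero) = Fintype.card V by linarith]
  · refine one_add_div_le_div_of_mul_le (by positivity) hr' (by linarith) ?_
    rwa [show (nminus : ℝ) + (nplus + nzero) = Fintype.card V by linarith]
end

section
/- Projector structure of vectorial colorings: let (x_{v,i} ∈ ℂ^d : v ∈ V, i ∈ {0,…,c−1}) be a finite family of vectors such that the sum y = ∑_{i∈[c]} x_{v,i} is the same unit vector for every v ∈ V, and ⟨x_{v,i}, x_{v,j}⟩ = 0 for every v ∈ V and all i ≠ j. Then there exist orthogonal projectors P_{v,i} ∈ ℂ^{d×d} such that ∑_{i∈[c]} P_{v,i} = I_d for every v ∈ V and P_{v,i} y = x_{v,i} for all v ∈ V, i ∈ [c]. -/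
open Matrix Finset

/-- The orthogonal projector onto the line spanned by `a` (zero when `a = 0`). -/
noncomputable def lineProjector {n : Type*} [Fintype n] (a : n → ℂ) : Matrix n n ℂ :=
  (star a ⬝ᵥ a)⁻¹ • vecMulVec a (star a)

lemma lineProjector_mulVec {n : Type*} [Fintype n] (a b : n → ℂ) :
    lineProjector a *ᵥ b = ((star a ⬝ᵥ a)⁻¹ * (star a ⬝ᵥ b)) • a := by
  ext i
  simp [lineProjector, smul_mulVec, vecMulVec_mulVec]
  ring

open scoped ComplexOrder in
lemma lineProjector_mulVec_self {n : Type*} [Fintype n] (a : n → ℂ) :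
    lineProjector a *ᵥ a = a := by
  rw [lineProjector_mulVec]
  by_cases ha : a = 0
  · simp [ha]
  · rw [inv_mul_cancel₀ (by rwa [Ne, dotProduct_star_self_eq_zero]), one_smul]

lemma lineProjector_mulVec_of_orthogonal {n : Type*} [Fintype n] {a b : n → ℂ}
    (h : star a ⬝ᵥ b = 0) : lineProjector a *ᵥ b = 0 := by
  simp [lineProjector_mulVec, h]

lemma lineProjector_isHermitian {n : Type*} [Fintype n] (a : n → ℂ) :
    (lineProjector a).IsHermitian := by
  have h : star (star a ⬝ᵥ a) = star a ⬝ᵥ a := by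
    rw [← star_dotProduct_star, star_star]
  rw [IsHermitian, lineProjector, conjTranspose_smul, conjTranspose_vecMulVec, star_star,
    star_inv₀, h]

lemma mul_lineProjector {n : Type*} [Fintype n] (M : Matrix n n ℂ) (a : n → ℂ) :
    M * lineProjector a = (star a ⬝ᵥ a)⁻¹ • vecMulVec (M *ᵥ a) (star a) := by
  rw [lineProjector, Matrix.mul_smul, mul_vecMulVec]

lemma lineProjector_mul_self {n : Type*} [Fintype n] (a : n → ℂ) :
    lineProjector a * lineProjector a = lineProjector a := by
  rw [mul_lineProjector, lineProjector_mulVec_self, lineProjector]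

lemma lineProjector_mul_of_orthogonal {n : Type*} [Fintype n] {a b : n → ℂ}
    (h : star a ⬝ᵥ b = 0) : lineProjector a * lineProjector b = 0 := by
  rw [mul_lineProjector, lineProjector_mulVec_of_orthogonal h]
  simp

/-- Pairwise orthogonal vectors, indexed by a nonempty type, are the images of their sum under
orthogonal projectors that add up to the identity. -/
lemma exists_projectors_of_pairwise_orthogonal {ι n : Type*} [Fintype ι] [DecidableEq ι]
    [Nonempty ι] [Fintype n] [DecidableEq n] (a : ι → n → ℂ)
    (h : ∀ i j, i ≠ j → star (a i) ⬝ᵥ a j = 0) :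
    ∃ P : ι → Matrix n n ℂ,
      (∀ i, (P i).IsHermitian ∧ P i * P i = P i) ∧ ∑ i, P i = 1 ∧
      ∀ i, P i *ᵥ ∑ j, a j = a i := by
  obtain ⟨k⟩ := ‹Nonempty ι›
  set Q : ι → Matrix n n ℂ := fun i => lineProjector (a i)
  set R : Matrix n n ℂ := 1 - ∑ i, Q i with hR
  have hQy (i : ι) : Q i *ᵥ ∑ j, a j = a i := by
    rw [mulVec_sum, Finset.sum_eq_single i
      (fun j _ hj => lineProjector_mulVec_of_orthogonal (h i j hj.symm)) (by simp)]
    exact lineProjector_mulVec_self _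
  have hQQ (i : ι) : Q i * Q i = Q i := lineProjector_mul_self _
  have hQherm (i : ι) : (Q i).IsHermitian := lineProjector_isHermitian _
  have hQR (i : ι) : Q i * R = 0 := by
    rw [hR, mul_sub, mul_one, Finset.mul_sum, Finset.sum_eq_single i
      (fun j _ hj => lineProjector_mul_of_orthogonal (h i j hj.symm)) (by simp), hQQ, sub_self]
  have hRherm : R.IsHermitian := by
    refine isHermitian_one.sub ?_
    rw [IsHermitian, conjTranspose_sum]
    exact Finset.sum_congr rfl fun i _ => hQherm i
  have hRQ (i : ι) : R * Q i = 0 := by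
    have := congrArg conjTranspose (hQR i)
    rwa [conjTranspose_mul, (hQherm i).eq, hRherm.eq, conjTranspose_zero] at this
  have hRR : R * R = R := by
    have hmul : (1 - ∑ i, Q i) * R = R := by
      rw [sub_mul, one_mul, Finset.sum_mul, Finset.sum_eq_zero fun i _ => hQR i, sub_zero]
    rwa [← hR] at hmul
  have hRy : R *ᵥ ∑ j, a j = 0 := by
    rw [hR, sub_mulVec, one_mulVec, sum_mulVec]
    simp [hQy]
  refine ⟨fun i => Q i + if i = k then R else 0, fun i => ?_, ?_, fun i => ?_⟩
  · beta_reduce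
    split_ifs
    · exact ⟨(hQherm i).add hRherm, by simp [mul_add, add_mul, hQQ, hQR, hRQ, hRR]⟩
    · simpa using ⟨hQherm i, hQQ i⟩
  · simp [Finset.sum_add_distrib, hR]
  · rw [add_mulVec, hQy]
    split_ifs <;> simp [hRy]

/-- Projector structure of vectorial colorings: if the vectors `x_{v,i} ∈ ℂ^d` satisfy
`∑_i x_{v,i} = y` (the same unit vector for every `v`) and `⟨x_{v,i}, x_{v,j}⟩ = 0`
for `i ≠ j`, then there are orthogonal projectors `P_{v,i}` with
`∑_i P_{v,i} = I_d` and `P_{v,i} y = x_{v,i}`. -/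
theorem projector_structure_of_vectorial_coloring
    {V : Type*} [Fintype V] [DecidableEq V]
    (c d : ℕ) (x : V → Fin c → Fin d → ℂ) (y : Fin d → ℂ)
    (h2 : ∀ v : V, ∑ i, x v i = y)
    (hy : star y ⬝ᵥ y = 1)
    (h3 : ∀ v : V, ∀ i j : Fin c, i ≠ j → star (x v i) ⬝ᵥ x v j = 0) :
    ∃ P : V → Fin c → Matrix (Fin d) (Fin d) ℂ,
      (∀ v i, (P v i).IsHermitian ∧ P v i * P v i = P v i) ∧
      (∀ v : V, ∑ i, P v i = 1) ∧
      (∀ v i, (P v i) *ᵥ y = x v i) := by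
  have hne : V → Nonempty (Fin c) := fun v => by
    by_contra hc
    rw [not_nonempty_iff] at hc
    have h0 := h2 v
    rw [Finset.univ_eq_empty, Finset.sum_empty] at h0
    simp [← h0] at hy
  have hP (v : V) := haveI := hne v; exists_projectors_of_pairwise_orthogonal (x v) (h3 v)
  choose P hproj hsum hy' using hP
  exact ⟨P, hproj, hsum, fun v i => h2 v ▸ hy' v i⟩
end

section
/- Compression eigenvalue inequality: let G be a finite simple graph with adjacency matrix A. If G admits a vectorial c-coloring with c ≥ 2, then for every real diagonal matrix E ∈ ℝ^{n×n}: λ_max(E − A) ≥ λ_max( E + (1/(c−1))·A ), where λ_max denotes the largest eigenvalue of a real symmetric matrix. -/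
open Matrix Finset
open scoped ComplexOrder

open scoped MatrixOrder in
/-- A real symmetric matrix whose eigenvalues are at most `t` is at most `t • 1` in the Loewner
order. -/
theorem Matrix.IsHermitian.posSemidef_smul_one_sub {V : Type*} [Fintype V] [DecidableEq V]
    {A : Matrix V V ℝ} (hA : A.IsHermitian) {t : ℝ} (ht : ∀ i, hA.eigenvalues i ≤ t) :
    (t • (1 : Matrix V V ℝ) - A).PosSemidef := by
  rw [← Matrix.le_iff, ← Algebra.algebraMap_eq_smul_one]
  refine le_algebraMap_of_spectrum_le (fun s hs => ?_) hA
  rw [hA.spectrum_real_eq_range_eigenvalues] at hs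
  obtain ⟨i, rfl⟩ := hs
  exact ht i

/-- A real symmetric matrix that is at most `t • 1` in the Loewner order has all its eigenvalues
at most `t`. -/
theorem Matrix.IsHermitian.eigenvalues_le_of_posSemidef_smul_one_sub {V : Type*} [Fintype V]
    [DecidableEq V] {A : Matrix V V ℝ} (hA : A.IsHermitian) {t : ℝ}
    (h : (t • (1 : Matrix V V ℝ) - A).PosSemidef) (i : V) : hA.eigenvalues i ≤ t := by
  have hi := h.dotProduct_mulVec_nonneg (hA.eigenvectorBasis i)
  have h_norm : star ⇑(hA.eigenvectorBasis i) ⬝ᵥ ⇑(hA.eigenvectorBasis i) = 1 := by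
    rw [dotProduct_comm, ← EuclideanSpace.inner_eq_star_dotProduct, real_inner_self_eq_norm_sq,
      hA.eigenvectorBasis.orthonormal.1 i, one_pow]
  rw [sub_mulVec, smul_mulVec, one_mulVec, hA.mulVec_eigenvectorBasis, dotProduct_sub,
    dotProduct_smul, dotProduct_smul, h_norm] at hi
  simpa using hi

/-- The entrywise real part of a complex positive semidefinite matrix is positive semidefinite. -/
theorem Matrix.PosSemidef.map_re {V : Type*} [Fintype V] {C : Matrix V V ℂ}
    (hC : C.PosSemidef) : (C.map Complex.re).PosSemidef := by
  refine .of_dotProduct_mulVec_nonneg ?_ fun z => ?_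
  · ext v w
    simpa using congrArg Complex.re (hC.isHermitian.apply v w)
  · have hz := (Complex.le_def.1 (hC.dotProduct_mulVec_nonneg fun v => (z v : ℂ))).1
    simpa [dotProduct, mulVec, Finset.mul_sum] using hz

/-- If `N` is positive semidefinite with unit diagonal and constant entry `-s` on the edges of `G`,
then `λ_max(E + s·A) ≤ λ_max(E - A)` for all diagonal `E`. -/
theorem iSup_eigenvalues_le_of_posSemidef {V : Type*} [Fintype V] [DecidableEq V]
    {G : SimpleGraph V} [DecidableRel G.Adj] {s : ℝ} {N : Matrix V V ℝ} (hN : N.PosSemidef)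
    (hN_diag : ∀ v, N v v = 1) (hN_adj : ∀ v w, G.Adj v w → N v w = -s)
    {E : Matrix V V ℝ} (hE : E.IsDiag) (hsub : (E - G.adjMatrix ℝ).IsHermitian)
    (hadd : (E + s • G.adjMatrix ℝ).IsHermitian) :
    (⨆ i, hadd.eigenvalues i) ≤ ⨆ i, hsub.eigenvalues i := by
  rcases isEmpty_or_nonempty V with _ | _
  · simp
  refine ciSup_le fun i => hadd.eigenvalues_le_of_posSemidef_smul_one_sub ?_ i
  have h_eq : (⨆ i, hsub.eigenvalues i) • (1 : Matrix V V ℝ) - (E + s • G.adjMatrix ℝ) =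
      ((⨆ i, hsub.eigenvalues i) • (1 : Matrix V V ℝ) - (E - G.adjMatrix ℝ)) ⊙ N := by
    ext v w
    rcases eq_or_ne v w with rfl | hvw
    · simp [hN_diag]
    · by_cases h : G.Adj v w <;> simp [h, hvw, hE hvw, hN_adj]
  rw [h_eq]
  exact (hsub.posSemidef_smul_one_sub
    fun i => le_ciSup (Set.finite_range hsub.eigenvalues).bddAbove i).hadamard hN

/-- The entries of the Gram matrix of the vectors `x v i - c⁻¹ • y`. -/
theorem sum_star_sub_dotProduct_sub {c d : ℕ} (hc : c ≠ 0) {p q : Fin c → Fin d → ℂ}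
    {y : Fin d → ℂ} (hp : ∑ i, p i = y) (hq : ∑ i, q i = y) (hy : star y ⬝ᵥ y = 1) :
    ∑ i, star (p i - (c : ℂ)⁻¹ • y) ⬝ᵥ (q i - (c : ℂ)⁻¹ • y) =
      ∑ i, star (p i) ⬝ᵥ q i - (c : ℂ)⁻¹ := by
  have hc' : (c : ℂ) ≠ 0 := Nat.cast_ne_zero.2 hc
  have hpy : ∑ i, star (p i) ⬝ᵥ y = 1 := by
    rw [← sum_dotProduct, ← star_sum, hp, hy]
  have hqy : ∑ i, star y ⬝ᵥ q i = 1 := by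
    rw [← dotProduct_sum, hq, hy]
  simp only [star_sub, star_smul, sub_dotProduct, dotProduct_sub, smul_dotProduct,
    dotProduct_smul, Finset.sum_sub_distrib, ← Finset.smul_sum, hpy, hqy, hy]
  simp [hc']

/-- In a vectorial coloring, the squared norms of the vectors at a vertex sum to one. -/
theorem sum_star_dotProduct_self_eq_one {c d : ℕ} {p : Fin c → Fin d → ℂ} {y : Fin d → ℂ}
    (hp : ∑ i, p i = y) (hy : star y ⬝ᵥ y = 1) (h : ∀ i j, i ≠ j → star (p i) ⬝ᵥ p j = 0) :
    ∑ i, star (p i) ⬝ᵥ p i = 1 := by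
  rw [← hy, ← hp, star_sum, sum_dotProduct]
  refine Finset.sum_congr rfl fun i _ => ?_
  rw [dotProduct_sum, Finset.sum_eq_single i (fun j _ hj => h i j hj.symm) (by simp)]

/-- Compression eigenvalue inequality: if `G` admits a vectorial `c`-coloring with
`c ≥ 2`, then for every real diagonal matrix `E`,
`λ_max(E - A) ≥ λ_max(E + (1/(c-1))·A)`. -/
theorem compression_eigenvalue_inequality
    {V : Type*} [Fintype V] [DecidableEq V] (G : SimpleGraph V) [DecidableRel G.Adj]
    (c d : ℕ) (hc : 2 ≤ c) (x : V → Fin c → Fin d → ℂ) (y : Fin d → ℂ)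
    (h1 : ∀ v w : V, ∀ i j : Fin c, 0 ≤ star (x v i) ⬝ᵥ x w j)
    (h2 : ∀ v : V, ∑ i, x v i = y)
    (hy : star y ⬝ᵥ y = 1)
    (h3 : ∀ v : V, ∀ i j : Fin c, i ≠ j → star (x v i) ⬝ᵥ x v j = 0)
    (h4 : ∀ v w : V, G.Adj v w → ∀ i : Fin c, star (x v i) ⬝ᵥ x w i = 0) :
    ∀ E : Matrix V V ℝ, E.IsDiag →
      ∀ (hsub : (E - SimpleGraph.adjMatrix ℝ G).IsHermitian)
        (hadd : (E + ((c : ℝ) - 1)⁻¹ • SimpleGraph.adjMatrix ℝ G).IsHermitian),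
        (⨆ i, hadd.eigenvalues i) ≤ ⨆ i, hsub.eigenvalues i := by
  intro E hE hsub hadd
  have hc_pos : (0 : ℝ) < c := by positivity
  have hc_one : (0 : ℝ) < (c : ℝ) - 1 := sub_pos.2 (by exact_mod_cast hc)
  let B : Matrix (Fin c × Fin d) V ℂ := fun k v => (x v k.1 - (c : ℂ)⁻¹ • y) k.2
  have hB v w : (Bᴴ * B) v w = ∑ i, star (x v i) ⬝ᵥ x w i - (c : ℂ)⁻¹ := by
    rw [← sum_star_sub_dotProduct_sub (by lia) (h2 v) (h2 w) hy, mul_apply, Fintype.sum_prod_type]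
    rfl
  refine iSup_eigenvalues_le_of_posSemidef
    (((posSemidef_conjTranspose_mul_self B).map_re).smul
      (show 0 ≤ (c : ℝ) / (c - 1) by positivity)) (fun v => ?_) (fun v w hvw => ?_) hE hsub hadd
  · have hre : ((1 : ℂ) - (c : ℂ)⁻¹).re = 1 - (c : ℝ)⁻¹ := by
      simp [← Complex.ofReal_natCast, ← Complex.ofReal_inv]
    rw [Matrix.smul_apply, map_apply, hB, sum_star_dotProduct_self_eq_one (h2 v) hy (h3 v), hre,
      smul_eq_mul]
    field_simp
  · have hre : ((0 : ℂ) - (c : ℂ)⁻¹).re = 0 - (c : ℝ)⁻¹ := by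
      simp [← Complex.ofReal_natCast, ← Complex.ofReal_inv]
    rw [Matrix.smul_apply, map_apply, hB, Finset.sum_eq_zero fun i _ => h4 v w hvw i, hre, smul_eq_mul]
    field_simp
    ring
end

section
/- Key step in the inertial bound for the orthogonal rank: let G be a finite simple graph with adjacency matrix A, and write A = B − C where B = ∑_{i : μ_i > 0} μ_i f_i f_i† and C = ∑_{i : μ_i < 0} (−μ_i) f_i f_i† are the positive and negative parts of A in its spectral decomposition (f_i orthonormal eigenvectors). Let P⁻ be the orthogonal projector onto the span of the eigenvectors of A with negative eigenvalues. Let (x_v)_{v∈V} be an orthogonal representation of G in dimension d with (x_v)_1 = 1 for all v, and set D_i = diag((x_v)_i : v ∈ V) for i = 1,…,d. Then the matrix P⁻ (∑_{i=2}^d D_i† B D_i) P⁻ − C is positive semidefinite. -/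
open Matrix Finset
open scoped ComplexOrder

/-- If `P` fixes the columns of `C` and has the same rank, then anything annihilating `C` on the
left annihilates `P`. -/
theorem Matrix.mul_eq_zero_of_mul_eq_zero_of_rank_eq {V K : Type*} [Fintype V] [DecidableEq V]
    [Field K] {B C P : Matrix V V K} (hBC : B * C = 0) (hPC : P * C = C)
    (hrank : P.rank = C.rank) : B * P = 0 := by
  have hle : LinearMap.range C.mulVecLin ≤ LinearMap.range P.mulVecLin := by
    rintro _ ⟨v, rfl⟩
    exact ⟨C *ᵥ v, by simp [Matrix.mulVec_mulVec, hPC]⟩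
  have heq := Submodule.eq_of_le_of_finrank_eq hle hrank.symm
  refine Matrix.ext_of_mulVec_single fun j => ?_
  obtain ⟨u, hu⟩ : P *ᵥ Pi.single j 1 ∈ LinearMap.range C.mulVecLin := heq ▸ ⟨_, rfl⟩
  rw [Matrix.mulVecLin_apply] at hu
  rw [← Matrix.mulVec_mulVec, ← hu, Matrix.mulVec_mulVec, hBC, Matrix.zero_mulVec,
    Matrix.zero_mulVec]

/-- Conjugating the adjacency matrix by the diagonal matrices of an orthogonal representation and
summing over the coordinates gives zero. -/
theorem SimpleGraph.sum_diagonal_conjTranspose_mul_adjMatrix_mul_diagonal_eq_zero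
    {V ι : Type*} [Fintype V] [DecidableEq V] [Fintype ι] (G : SimpleGraph V) [DecidableRel G.Adj]
    (x : V → ι → ℂ) (horth : ∀ v w, G.Adj v w → star (x v) ⬝ᵥ x w = 0) :
    ∑ i, (Matrix.diagonal fun v => x v i)ᴴ * G.adjMatrix ℂ * (Matrix.diagonal fun v => x v i)
      = 0 := by
  ext v w
  simp only [Matrix.sum_apply, Matrix.diagonal_conjTranspose, Matrix.mul_diagonal,
    Matrix.diagonal_mul, SimpleGraph.adjMatrix_apply]
  by_cases h : G.Adj v w
  · simpa [h, dotProduct] using horth v w h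
  · simp [h]

/-- Key step in the inertial bound for the orthogonal rank: write `A = B - C` with
`B`, `C` the positive and negative parts of the spectral decomposition of the
adjacency matrix (characterized by: `B, C ⪰ 0`, `A = B - C`, `B C = 0`), and let `P⁻`
be the orthogonal projector onto the span of the eigenvectors with negative
eigenvalues (characterized by: Hermitian idempotent, `P⁻ C = C`, `rank P⁻ = rank C`).
If `(x_v)` is an orthogonal representation in dimension `d` with `(x_v)_1 = 1`, and
`D_i = diag((x_v)_i)`, then `P⁻ (∑_{i=2}^d D_i† B D_i) P⁻ − C` is positive
semidefinite. -/
theorem key_step_inertial_bound_orthogonal_rank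
    {V : Type*} [Fintype V] [DecidableEq V] (G : SimpleGraph V) [DecidableRel G.Adj]
    (B C Pminus : Matrix V V ℂ)
    (hB : B.PosSemidef) (hC : C.PosSemidef)
    (hA : SimpleGraph.adjMatrix ℂ G = B - C)
    (hBC : B * C = 0)
    (hPH : Pminus.IsHermitian) (hPI : Pminus * Pminus = Pminus)
    (hPC : Pminus * C = C) (hPrank : Pminus.rank = C.rank)
    (d : ℕ) (hd : 0 < d) (x : V → Fin d → ℂ)
    (hx : ∀ v, x v ≠ 0)
    (hx1 : ∀ v, x v ⟨0, hd⟩ = 1)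
    (horth : ∀ v w, G.Adj v w → star (x v) ⬝ᵥ x w = 0) :
    (Pminus *
        (∑ i ∈ univ.erase (⟨0, hd⟩ : Fin d),
          (Matrix.diagonal fun v => x v i)ᴴ * B * Matrix.diagonal fun v => x v i) *
        Pminus - C).PosSemidef := by
  have hBP : B * Pminus = 0 := Matrix.mul_eq_zero_of_mul_eq_zero_of_rank_eq hBC hPC hPrank
  have hCP : C * Pminus = C := by
    simpa [Matrix.conjTranspose_mul, hPH.eq, hC.isHermitian.eq] using
      congrArg Matrix.conjTranspose hPC
  have hsum := G.sum_diagonal_conjTranspose_mul_adjMatrix_mul_diagonal_eq_zero x horth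
  rw [← Finset.add_sum_erase _ _ (Finset.mem_univ (⟨0, hd⟩ : Fin d))] at hsum
  simp only [hx1, Matrix.diagonal_one, Matrix.conjTranspose_one, one_mul, mul_one, hA,
    mul_sub, sub_mul, Finset.sum_sub_distrib] at hsum
  set S := ∑ i ∈ univ.erase (⟨0, hd⟩ : Fin d),
    (Matrix.diagonal fun v => x v i)ᴴ * B * Matrix.diagonal fun v => x v i
  set T := ∑ i ∈ univ.erase (⟨0, hd⟩ : Fin d),
    (Matrix.diagonal fun v => x v i)ᴴ * C * Matrix.diagonal fun v => x v i
  have hTpos : T.PosSemidef :=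
    Matrix.posSemidef_sum _ fun i _ => hC.conjTranspose_mul_mul_same _
  have hS : S = T + C - B := by
    rw [← sub_eq_zero, ← hsum]
    abel
  have key : Pminus * S * Pminus - C = Pminusᴴ * T * Pminus := by
    rw [hS, hPH.eq, mul_sub, mul_add, sub_mul, add_mul, mul_assoc Pminus B, hBP, hPC, hCP,
      mul_zero, sub_zero, add_sub_cancel_right]
  rw [key]
  exact hTpos.conjTranspose_mul_mul_same _
end
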